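/- Let (u, p) be a C^∞ solution of the stationary incompressible Navier–Stokes equations on ℝ³. Let 0 < γ < 3 ≤ p < +∞ be such that η(γ,p) = γ/p − 3/p + 2/3 < 0. If u belongs to M^p_γ(ℝ³) (the limit condition over annuli is not required), then u ≡ 0 and p is a constant function. -/

import Mathlib

open MeasureTheory Filter Metric Real

noncomputable section

/-- Three-dimensional Euclidean space. -/
abbrev E3 : Type := EuclideanSpace ℝ (Fin 3)

/-- Partial derivative `∂_j f` of a scalar field. -/
def pd (j : Fin 3) (f : E3 → ℝ) (x : E3) : ℝ :=
  fderiv ℝ f x (EuclideanSpace.single j 1)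

/-- Laplacian of a scalar field. -/
def lap (f : E3 → ℝ) (x : E3) : ℝ := ∑ j, pd j (pd j f) x

/-- The annulus `C(R/2, R)`. -/
def ann (R : ℝ) : Set E3 := {x : E3 | R / 2 < ‖x‖ ∧ ‖x‖ < R}

/-- Euclidean length `|u(x)|` of a vector field. -/
def vecNorm (u : E3 → Fin 3 → ℝ) (x : E3) : ℝ := Real.sqrt (∑ i, (u x i) ^ 2)

/-- The stationary incompressible Navier–Stokes equations:
`−Δu + (u·∇)u + ∇p = 0`, `div u = 0`. -/
def StatNS (u : E3 → Fin 3 → ℝ) (P : E3 → ℝ) : Prop :=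
  (∀ x : E3, ∀ i : Fin 3,
    -(lap (fun y => u y i) x) + (∑ j, u x j * pd j (fun y => u y i) x)
      + pd i P x = 0) ∧
  (∀ x : E3, ∑ j, pd j (fun y => u y j) x = 0)

/-- Membership in the local Morrey space `M^p_γ(ℝ³)`. -/
def MemMorrey (p γ : ℝ) (f : E3 → ℝ) : Prop :=
  LocallyIntegrable (fun x => |f x| ^ p) volume ∧
  ∃ C : ℝ, ∀ R : ℝ, 1 ≤ R → R ^ (-γ) * ∫ x in ball (0 : E3) R, |f x| ^ p ≤ C

/-- Membership in `M^p_{γ,0}(ℝ³)`. -/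
def MemMorrey0 (p γ : ℝ) (f : E3 → ℝ) : Prop :=
  MemMorrey p γ f ∧
  Tendsto (fun R : ℝ => R ^ (-γ) * ∫ x in ann R, |f x| ^ p) atTop (nhds 0)

/-! ### Calculus of partial derivatives -/

theorem pd_contDiff {f : E3 → ℝ} (hf : ContDiff ℝ (⊤ : ℕ∞) f) (j : Fin 3) :
    ContDiff ℝ (⊤ : ℕ∞) (pd j f) := by
  have h : ContDiff ℝ (⊤ : ℕ∞) (fderiv ℝ f) := hf.fderiv_right (by simp)
  exact h.clm_apply contDiff_const

theorem ContDiff.diff_top {f : E3 → ℝ} (hf : ContDiff ℝ (⊤ : ℕ∞) f) : Differentiable ℝ f :=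
  hf.differentiable (by simp)

theorem pd_mul {f g : E3 → ℝ} (hf : ContDiff ℝ (⊤ : ℕ∞) f) (hg : ContDiff ℝ (⊤ : ℕ∞) g)
    (j : Fin 3) (x : E3) :
    pd j (fun y => f y * g y) x = pd j f x * g x + f x * pd j g x := by
  unfold pd
  rw [fderiv_fun_mul (hf.diff_top x) (hg.diff_top x)]
  simp
  ring

theorem pd_sum {ι : Type*} (s : Finset ι) {f : ι → E3 → ℝ}
    (hf : ∀ i ∈ s, ContDiff ℝ (⊤ : ℕ∞) (f i)) (j : Fin 3) (x : E3) :
    pd j (fun y => ∑ i ∈ s, f i y) x = ∑ i ∈ s, pd j (f i) x := by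
  unfold pd
  rw [fderiv_fun_sum (fun i hi => (hf i hi).diff_top x)]
  simp

theorem pd_comp_smul {f : E3 → ℝ} (hf : ContDiff ℝ (⊤ : ℕ∞) f) (r : ℝ) (j : Fin 3) (x : E3) :
    pd j (fun y => f (r • y)) x = r * pd j f (r • x) := by
  unfold pd
  have h1 : HasFDerivAt (fun y : E3 => r • y) (r • ContinuousLinearMap.id ℝ E3) x :=
    (hasFDerivAt_id x).const_smul r
  have h2 := ((hf.diff_top (r • x)).hasFDerivAt).comp x h1
  have h3 : fderiv ℝ (fun y => f (r • y)) x = _ := h2.fderiv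
  rw [h3]
  simp

theorem pd_const_mul {f : E3 → ℝ} (hf : ContDiff ℝ (⊤ : ℕ∞) f) (r : ℝ) (j : Fin 3) (x : E3) :
    pd j (fun y => r * f y) x = r * pd j f x := by
  unfold pd
  rw [fderiv_const_mul (hf.diff_top x)]
  simp

/-- `f` vanishes outside the closed ball of radius `r`. -/
def VanishOut (r : ℝ) (f : E3 → ℝ) : Prop := ∀ x : E3, r < ‖x‖ → f x = 0

theorem VanishOut.pd {r : ℝ} {f : E3 → ℝ} (hf : VanishOut r f) (j : Fin 3) :
    VanishOut r (pd j f) := by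
  intro x hx
  have h : f =ᶠ[nhds x] fun _ => 0 := by
    filter_upwards [(isOpen_lt continuous_const continuous_norm).mem_nhds hx] with y hy
    exact hf y hy
  unfold _root_.pd
  rw [h.fderiv_eq]
  simp

theorem VanishOut.mul_right {r : ℝ} {f : E3 → ℝ} (hf : VanishOut r f) (g : E3 → ℝ) :
    VanishOut r (fun x => f x * g x) := fun x hx => by simp [hf x hx]

theorem VanishOut.hasCompactSupport {r : ℝ} {f : E3 → ℝ} (hf : VanishOut r f) :
    HasCompactSupport f :=
  HasCompactSupport.intro (isCompact_closedBall (0 : E3) r) fun x hx => hf x (by simpa using hx)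

theorem VanishOut.sum {r : ℝ} {ι : Type*} {s : Finset ι} {f : ι → E3 → ℝ}
    (hf : ∀ i ∈ s, VanishOut r (f i)) : VanishOut r (fun x => ∑ i ∈ s, f i x) :=
  fun x hx => Finset.sum_eq_zero fun i hi => hf i hi x hx

theorem integral_fderiv_apply_eq_zero {W : Type*} [NormedAddCommGroup W] [NormedSpace ℝ W]
    [FiniteDimensional ℝ W] [MeasurableSpace W] [BorelSpace W] (μ : Measure W)
    [μ.IsAddHaarMeasure] {F : W → ℝ} (hF : ContDiff ℝ 1 F) (hc : HasCompactSupport F) (v : W) :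
    ∫ w, fderiv ℝ F w v ∂μ = 0 := by
  have hcont : Continuous fun w => fderiv ℝ F w v :=
    (hF.continuous_fderiv (by simp)).clm_apply continuous_const
  have hi : Integrable (fun w => fderiv ℝ F w v) μ :=
    hcont.integrable_of_hasCompactSupport (hc.fderiv_apply ℝ v)
  have h := integral_mul_fderiv_eq_neg_fderiv_mul_of_integrable (μ := μ) (𝕜 := ℝ)
    (f := fun _ : W => (1 : ℝ)) (g := F) (v := v) (by simp) (by simpa using hi)
    (by simpa using hF.continuous.integrable_of_hasCompactSupport hc)
    (fun x _ => differentiableAt_const _) (fun x _ => hF.differentiable (by simp) x)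
  simpa using h

/-! ### The two-point pairing -/

instance isAddHaarMeasure_volume_prod : (volume : Measure (E3 × E3)).IsAddHaarMeasure :=
  inferInstanceAs ((volume : Measure E3).prod (volume : Measure E3)).IsAddHaarMeasure

/-- The pairing `∫∫ c(x) b(y) a(x + s y) dx dy`. -/
def pairing (s : ℝ) (a b c : E3 → ℝ) : ℝ :=
  ∫ w : E3 × E3, c w.1 * b w.2 * a (w.1 + s • w.2)

theorem pairing_hasCompactSupport {b c : E3 → ℝ} (s : ℝ) (a : E3 → ℝ)
    (hbc : HasCompactSupport b) (hcc : HasCompactSupport c) :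
    HasCompactSupport (fun w : E3 × E3 => c w.1 * b w.2 * a (w.1 + s • w.2)) := by
  refine HasCompactSupport.intro (hcc.isCompact.prod hbc.isCompact) fun w hw => ?_
  by_cases h1 : c w.1 = 0
  · simp [h1]
  by_cases h2 : b w.2 = 0
  · simp [h2]
  exact absurd ⟨subset_tsupport _ h1, subset_tsupport _ h2⟩ hw

theorem pairing_integrable {a b c : E3 → ℝ} (s : ℝ) (ha : Continuous a) (hb : Continuous b)
    (hc : Continuous c) (hbc : HasCompactSupport b) (hcc : HasCompactSupport c) :
    Integrable (fun w : E3 × E3 => c w.1 * b w.2 * a (w.1 + s • w.2)) := by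
  refine Continuous.integrable_of_hasCompactSupport (by fun_prop)
    (pairing_hasCompactSupport s a hbc hcc)

theorem pairing_sum_left {ι : Type*} (t : Finset ι) {a : ι → E3 → ℝ} {b c : E3 → ℝ} (s : ℝ)
    (ha : ∀ i ∈ t, Continuous (a i)) (hb : Continuous b)
    (hc : Continuous c) (hbc : HasCompactSupport b) (hcc : HasCompactSupport c) :
    pairing s (fun x => ∑ i ∈ t, a i x) b c = ∑ i ∈ t, pairing s (a i) b c := by
  unfold pairing
  rw [← integral_finsetSum _ fun i hi => pairing_integrable s (ha i hi) hb hc hbc hcc]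
  simp_rw [Finset.mul_sum]

theorem pairing_sub_left {a a' b c : E3 → ℝ} (s : ℝ)
    (ha : Continuous a) (ha' : Continuous a') (hb : Continuous b)
    (hc : Continuous c) (hbc : HasCompactSupport b) (hcc : HasCompactSupport c) :
    pairing s (fun x => a x - a' x) b c = pairing s a b c - pairing s a' b c := by
  unfold pairing
  rw [← integral_sub (pairing_integrable s ha hb hc hbc hcc)
    (pairing_integrable s ha' hb hc hbc hcc)]
  simp_rw [mul_sub]

theorem pairing_sum_right {ι : Type*} (t : Finset ι) {a b : E3 → ℝ} {c : ι → E3 → ℝ} (s : ℝ)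
    (ha : Continuous a) (hb : Continuous b)
    (hc : ∀ i ∈ t, Continuous (c i)) (hbc : HasCompactSupport b)
    (hcc : ∀ i ∈ t, HasCompactSupport (c i)) :
    pairing s a b (fun x => ∑ i ∈ t, c i x) = ∑ i ∈ t, pairing s a b (c i) := by
  unfold pairing
  rw [← integral_finsetSum _ fun i hi => pairing_integrable s ha hb (hc i hi) hbc (hcc i hi)]
  simp_rw [Finset.sum_mul]

theorem pairing_hasFDerivAt {a b c : E3 → ℝ} (s : ℝ) (ha : ContDiff ℝ (⊤ : ℕ∞) a)
    (hb : ContDiff ℝ (⊤ : ℕ∞) b) (hc : ContDiff ℝ (⊤ : ℕ∞) c) (w v : E3 × E3) :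
    fderiv ℝ (fun w : E3 × E3 => c w.1 * b w.2 * a (w.1 + s • w.2)) w v =
      fderiv ℝ c w.1 v.1 * b w.2 * a (w.1 + s • w.2)
      + c w.1 * fderiv ℝ b w.2 v.2 * a (w.1 + s • w.2)
      + c w.1 * b w.2 * fderiv ℝ a (w.1 + s • w.2) (v.1 + s • v.2) := by
  have h1 : HasFDerivAt (fun w : E3 × E3 => c w.1) _ w :=
    (hc.diff_top w.1).hasFDerivAt.comp w hasFDerivAt_fst
  have h2 : HasFDerivAt (fun w : E3 × E3 => b w.2) _ w :=
    (hb.diff_top w.2).hasFDerivAt.comp w hasFDerivAt_snd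
  have h0 : HasFDerivAt (fun w : E3 × E3 => w.1 + s • w.2)
      (ContinuousLinearMap.fst ℝ E3 E3 + s • ContinuousLinearMap.snd ℝ E3 E3) w :=
    hasFDerivAt_fst.add (hasFDerivAt_snd.const_smul s)
  have h3 : HasFDerivAt (fun w : E3 × E3 => a (w.1 + s • w.2)) _ w :=
    (ha.diff_top (w.1 + s • w.2)).hasFDerivAt.comp w h0
  have h4 : fderiv ℝ (fun w : E3 × E3 => c w.1 * b w.2 * a (w.1 + s • w.2)) w = _ :=
    ((h1.mul h2).mul h3).fderiv
  rw [h4]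
  simp
  ring

theorem pairing_contDiff {a b c : E3 → ℝ} (s : ℝ) (ha : ContDiff ℝ (⊤ : ℕ∞) a)
    (hb : ContDiff ℝ (⊤ : ℕ∞) b) (hc : ContDiff ℝ (⊤ : ℕ∞) c) :
    ContDiff ℝ 1 (fun w : E3 × E3 => c w.1 * b w.2 * a (w.1 + s • w.2)) := by
  have ha' : ContDiff ℝ 1 a := ha.of_le (by simp)
  have hb' : ContDiff ℝ 1 b := hb.of_le (by simp)
  have hc' : ContDiff ℝ 1 c := hc.of_le (by simp)
  fun_prop

theorem pairing_pd_right {a b c : E3 → ℝ} (s : ℝ) (ha : ContDiff ℝ (⊤ : ℕ∞) a)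
    (hb : ContDiff ℝ (⊤ : ℕ∞) b) (hc : ContDiff ℝ (⊤ : ℕ∞) c)
    (hbc : HasCompactSupport b) (hcc : HasCompactSupport c) (j : Fin 3) :
    pairing s (pd j a) b c = - pairing s a b (pd j c) := by
  have h := integral_fderiv_apply_eq_zero (volume : Measure (E3 × E3))
    (pairing_contDiff s ha hb hc) (pairing_hasCompactSupport s a hbc hcc)
    (EuclideanSpace.single j 1, 0)
  have hcp : HasCompactSupport (pd j c) := hcc.fderiv_apply ℝ _
  have i1 := pairing_integrable s ha.continuous hb.continuous (pd_contDiff hc j).continuous hbc hcp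
  have i2 := pairing_integrable s (pd_contDiff ha j).continuous hb.continuous hc.continuous hbc hcc
  simp_rw [pairing_hasFDerivAt s ha hb hc] at h
  simp only [map_zero, mul_zero, zero_mul, add_zero, smul_zero] at h
  have h' := integral_add i1 i2
  unfold pairing
  unfold pd at h' ⊢
  linarith

theorem pairing_pd_middle {a b c : E3 → ℝ} (s : ℝ) (ha : ContDiff ℝ (⊤ : ℕ∞) a)
    (hb : ContDiff ℝ (⊤ : ℕ∞) b) (hc : ContDiff ℝ (⊤ : ℕ∞) c)
    (hbc : HasCompactSupport b) (hcc : HasCompactSupport c) (j : Fin 3) :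
    s * pairing s (pd j a) b c = - pairing s a (pd j b) c := by
  have h := integral_fderiv_apply_eq_zero (volume : Measure (E3 × E3))
    (pairing_contDiff s ha hb hc) (pairing_hasCompactSupport s a hbc hcc)
    (0, EuclideanSpace.single j 1)
  have hbp : HasCompactSupport (pd j b) := hbc.fderiv_apply ℝ _
  have i1 := pairing_integrable s ha.continuous (pd_contDiff hb j).continuous hc.continuous hbp hcc
  have i2 := (pairing_integrable s (pd_contDiff ha j).continuous hb.continuous hc.continuous
    hbc hcc).const_mul s
  simp_rw [pairing_hasFDerivAt s ha hb hc] at h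
  simp only [map_zero, zero_mul, zero_add, map_smul, smul_eq_mul] at h
  have h' := integral_add i1 i2
  rw [integral_const_mul] at h'
  unfold pairing
  unfold pd at h' ⊢
  have e : ∀ w : E3 × E3, c w.1 * b w.2 *
        (s * (fderiv ℝ a (w.1 + s • w.2)) (EuclideanSpace.single j 1)) =
      s * (c w.1 * b w.2 * (fderiv ℝ a (w.1 + s • w.2)) (EuclideanSpace.single j 1)) :=
    fun w => by ring
  simp_rw [e] at h
  linarith

theorem pairing_hasDerivAt {a b c : E3 → ℝ} (s : ℝ) (ha : ContDiff ℝ (⊤ : ℕ∞) a)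
    (hb : ContDiff ℝ (⊤ : ℕ∞) b) (hc : ContDiff ℝ (⊤ : ℕ∞) c)
    (hbc : HasCompactSupport b) (hcc : HasCompactSupport c) :
    HasDerivAt (fun t => pairing t a b c)
      (∑ i, pairing s (pd i a) (fun y => y i * b y) c) s := by
  have key : ∀ (t : ℝ) (w : E3 × E3), HasDerivAt
      (fun t => c w.1 * b w.2 * a (w.1 + t • w.2))
      (c w.1 * b w.2 * fderiv ℝ a (w.1 + t • w.2) w.2) t := by
    intro t w
    have h0 : HasDerivAt (fun t : ℝ => w.1 + t • w.2) w.2 t := by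
      simpa using ((hasDerivAt_id t).smul_const w.2).const_add w.1
    exact ((ha.diff_top _).hasFDerivAt.comp_hasDerivAt t h0).const_mul _
  have hcontF : Continuous fun q : ℝ × (E3 × E3) =>
      c q.2.1 * b q.2.2 * fderiv ℝ a (q.2.1 + q.1 • q.2.2) q.2.2 := by
    have h1 : Continuous (fderiv ℝ a) := ha.continuous_fderiv (by simp)
    have h2 := hb.continuous
    have h3 := hc.continuous
    have h4 : Continuous fun q : ℝ × (E3 × E3) => fderiv ℝ a (q.2.1 + q.1 • q.2.2) q.2.2 :=
      (h1.comp (by fun_prop)).clm_apply (by fun_prop)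
    exact ((h3.comp (by fun_prop)).mul (h2.comp (by fun_prop))).mul h4
  set K : Set (E3 × E3) := tsupport c ×ˢ tsupport b with hK
  have hKc : IsCompact K := hcc.isCompact.prod hbc.isCompact
  obtain ⟨B, hB⟩ := ((isCompact_Icc (a := s - 1) (b := s + 1)).prod hKc).exists_bound_of_continuousOn
    hcontF.continuousOn
  have hzero : ∀ w ∉ K, c w.1 * b w.2 = 0 := by
    intro w hw
    by_contra hne
    exact hw ⟨subset_tsupport _ (left_ne_zero_of_mul hne),
      subset_tsupport _ (right_ne_zero_of_mul hne)⟩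
  have hmain := hasDerivAt_integral_of_dominated_loc_of_deriv_le (μ := (volume : Measure (E3 × E3)))
    (F := fun t w => c w.1 * b w.2 * a (w.1 + t • w.2))
    (F' := fun t w => c w.1 * b w.2 * fderiv ℝ a (w.1 + t • w.2) w.2) (x₀ := s)
    (s := Set.Icc (s - 1) (s + 1)) (bound := K.indicator fun _ => B)
    (Icc_mem_nhds (by linarith) (by linarith))
    (Eventually.of_forall fun t => (pairing_integrable t ha.continuous hb.continuous hc.continuous
      hbc hcc).aestronglyMeasurable)
    (pairing_integrable s ha.continuous hb.continuous hc.continuous hbc hcc)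
    (by
      have : Continuous fun w : E3 × E3 => c w.1 * b w.2 * fderiv ℝ a (w.1 + s • w.2) w.2 :=
        hcontF.comp (by fun_prop : Continuous fun w : E3 × E3 => (s, w))
      exact this.aestronglyMeasurable)
    (Eventually.of_forall fun w t ht => by
      by_cases hw : w ∈ K
      · rw [Set.indicator_of_mem hw]
        exact hB (t, w) ⟨ht, hw⟩
      · rw [Set.indicator_of_notMem hw, hzero w hw]
        simp)
    ((integrable_indicator_iff hKc.isClosed.measurableSet).2
      (integrableOn_const hKc.measure_lt_top.ne))
    (Eventually.of_forall fun w t _ => key t w)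
  suffices h : ∑ i, pairing s (pd i a) (fun y => y i * b y) c =
      ∫ w : E3 × E3, c w.1 * b w.2 * fderiv ℝ a (w.1 + s • w.2) w.2 by
    rw [h]
    exact hmain.2
  unfold pairing
  rw [← integral_finsetSum]
  · congr 1
    ext w
    have hexp : w.2 = ∑ i, w.2 i • (EuclideanSpace.single i 1 : E3) := by
      ext k
      simp [Pi.single_apply]
    conv_rhs => rw [show fderiv ℝ a (w.1 + s • w.2) w.2 =
      fderiv ℝ a (w.1 + s • w.2) (∑ i, w.2 i • (EuclideanSpace.single i 1 : E3)) from by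
        rw [← hexp]]
    rw [map_sum, Finset.mul_sum]
    refine Finset.sum_congr rfl fun i _ => ?_
    rw [map_smul]
    unfold pd
    simp only [smul_eq_mul]
    ring
  · intro i _
    exact pairing_integrable s (pd_contDiff ha i).continuous
      ((by fun_prop : Continuous fun y : E3 => y i).mul hb.continuous) hc.continuous
      hbc.mul_left hcc
/-! ### Cutoff and mollification kernels -/

theorem pd_sq_norm_comp {h h' : ℝ → ℝ} (hh : ∀ t, HasDerivAt h (h' t) t) (i : Fin 3) (y : E3) :
    pd i (fun y => h (1 - ‖y‖ ^ 2)) y = -(2 * y i * h' (1 - ‖y‖ ^ 2)) := by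
  have h1 : HasFDerivAt (fun y : E3 => 1 - ‖y‖ ^ 2) (-(2 • innerSL ℝ y)) y :=
    (hasStrictFDerivAt_norm_sq y).hasFDerivAt.const_sub 1
  have h2 := (hh (1 - ‖y‖ ^ 2)).comp_hasFDerivAt y h1
  have h3 : fderiv ℝ (fun y : E3 => h (1 - ‖y‖ ^ 2)) y = _ := h2.fderiv
  unfold pd
  rw [h3]
  simp [EuclideanSpace.inner_single_right]
  ring

theorem exists_mollifier : ∃ Θ ρ : E3 → ℝ, ContDiff ℝ (⊤ : ℕ∞) Θ ∧ ContDiff ℝ (⊤ : ℕ∞) ρ ∧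
    VanishOut 1 Θ ∧ VanishOut 1 ρ ∧ (∀ i y, pd i Θ y = -(y i * ρ y)) ∧ 0 < ∫ y, ρ y := by
  have hd : ∀ t, HasDerivAt expNegInvGlue ((t⁻¹) ^ 2 * expNegInvGlue t) t := by
    intro t
    simpa using expNegInvGlue.hasDerivAt_polynomial_eval_inv_mul 1 t
  have hs : ContDiff ℝ (⊤ : ℕ∞) fun t : ℝ => (t⁻¹) ^ 2 * expNegInvGlue t := by
    have h := expNegInvGlue.contDiff_polynomial_eval_inv_mul (n := ⊤)
      (Polynomial.X ^ 2 : Polynomial ℝ)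
    have e : (fun t : ℝ => (t⁻¹) ^ 2 * expNegInvGlue t) =
        fun t => (Polynomial.X ^ 2 : Polynomial ℝ).eval t⁻¹ * expNegInvGlue t := by
      funext t
      rw [Polynomial.eval_pow, Polynomial.eval_X]
    rw [e]
    exact h
  have hn : ContDiff ℝ (⊤ : ℕ∞) fun y : E3 => 1 - ‖y‖ ^ 2 :=
    contDiff_const.sub (contDiff_norm_sq ℝ)
  have hv : ∀ y : E3, 1 < ‖y‖ → expNegInvGlue (1 - ‖y‖ ^ 2) = 0 := fun y hy =>
    expNegInvGlue.zero_of_nonpos (by nlinarith)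
  have hρs : ContDiff ℝ (⊤ : ℕ∞)
      fun y : E3 => 2 * (((1 - ‖y‖ ^ 2)⁻¹) ^ 2 * expNegInvGlue (1 - ‖y‖ ^ 2)) :=
    contDiff_const.mul (hs.comp hn)
  have hρv : VanishOut 1
      fun y : E3 => 2 * (((1 - ‖y‖ ^ 2)⁻¹) ^ 2 * expNegInvGlue (1 - ‖y‖ ^ 2)) := by
    intro y hy
    simp [hv y hy]
  refine ⟨fun y => expNegInvGlue (1 - ‖y‖ ^ 2), _, expNegInvGlue.contDiff.comp hn,
    hρs, hv, hρv, fun i y => ?_, ?_⟩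
  · rw [pd_sq_norm_comp hd]
    ring
  · refine (hρs.continuous.integral_pos_of_hasCompactSupport_nonneg_nonzero
      hρv.hasCompactSupport ?_ (x := 0) ?_)
    · intro y
      have := expNegInvGlue.nonneg (1 - ‖y‖ ^ 2)
      positivity
    · have := expNegInvGlue.pos_of_pos (x := 1) one_pos
      simp [this.ne']

theorem exists_cutoff : ∃ χ : E3 → ℝ, ContDiff ℝ (⊤ : ℕ∞) χ ∧ VanishOut 2 χ ∧
    (∀ x, ‖x‖ ≤ 1 → χ x = 1) := by
  let χ : ContDiffBump (0 : E3) := ⟨1, 2, one_pos, one_lt_two⟩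
  refine ⟨χ, χ.contDiff, fun x hx => χ.zero_of_le_dist ?_, fun x hx => χ.one_of_mem_closedBall ?_⟩
  · simpa using hx.le
  · simpa using hx

theorem VanishOut.exists_bound {r : ℝ} {f : E3 → ℝ} (hf : VanishOut r f) (hc : Continuous f) :
    ∃ C, 0 ≤ C ∧ ∀ x, |f x| ≤ C := by
  obtain ⟨C, hC⟩ := hf.hasCompactSupport.exists_bound_of_continuous hc
  exact ⟨C, (norm_nonneg _).trans (hC 0), hC⟩

/-- `ψ` is a cutoff between the balls of radii `R` and `2R` which is the square of a smooth
function, with scaled derivative bounds controlled by `C`. -/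
structure ScaledCutoff (C R : ℝ) (ψ : E3 → ℝ) : Prop where
  contDiff : ContDiff ℝ (⊤ : ℕ∞) ψ
  vanishOut : VanishOut (2 * R) ψ
  eq_one : ∀ x, ‖x‖ ≤ R → ψ x = 1
  nonneg : ∀ x, 0 ≤ ψ x
  le : ∀ x, ψ x ≤ C
  sq_pd_le : ∀ i x, (R * pd i ψ x) ^ 2 ≤ C * ψ x
  abs_pd_le : ∀ i x, |pd i ψ x| ≤ C / R
  abs_pd_pd_le : ∀ i j x, |pd j (pd i ψ) x| ≤ C / R ^ 2

theorem exists_scaledCutoff :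
    ∃ C, 0 ≤ C ∧ ∀ R : ℝ, 1 ≤ R → ∃ ψ : E3 → ℝ, ScaledCutoff C R ψ := by
  obtain ⟨χ, hχ, hχv, hχ1⟩ := exists_cutoff
  have hχχ : ContDiff ℝ (⊤ : ℕ∞) fun x => χ x * χ x := hχ.mul hχ
  have hv2 : VanishOut 2 fun x => χ x * χ x := hχv.mul_right χ
  obtain ⟨C0, hC0, h0⟩ := hv2.exists_bound hχχ.continuous
  choose C1 hC1 h1 using fun i => (hχv.pd i).exists_bound (pd_contDiff hχ i).continuous
  choose C2 hC2 h2 using fun i => (hv2.pd i).exists_bound (pd_contDiff hχχ i).continuous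
  choose C3 hC3 h3 using fun i j =>
    ((hv2.pd i).pd j).exists_bound (pd_contDiff (pd_contDiff hχχ i) j).continuous
  refine ⟨C0 + ∑ i, 4 * C1 i ^ 2 + ∑ i, C2 i + ∑ i, ∑ j, C3 i j, ?_, fun R hR => ?_⟩
  · have a1 : 0 ≤ ∑ i, 4 * C1 i ^ 2 := Finset.sum_nonneg fun i _ => by positivity
    have a2 : 0 ≤ ∑ i, C2 i := Finset.sum_nonneg fun i _ => hC2 i
    have a3 : 0 ≤ ∑ i, ∑ j, C3 i j :=
      Finset.sum_nonneg fun i _ => Finset.sum_nonneg fun j _ => hC3 i j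
    linarith
  have b1 : ∀ i, 4 * C1 i ^ 2 ≤ ∑ i, 4 * C1 i ^ 2 := fun i =>
    Finset.single_le_sum (f := fun i => 4 * C1 i ^ 2) (fun i _ => by positivity) (Finset.mem_univ i)
  have b2 : ∀ i, C2 i ≤ ∑ i, C2 i := fun i =>
    Finset.single_le_sum (fun i _ => hC2 i) (Finset.mem_univ i)
  have b3 : ∀ i j, C3 i j ≤ ∑ i, ∑ j, C3 i j := fun i j =>
    (Finset.single_le_sum (f := fun j => C3 i j) (fun j _ => hC3 i j) (Finset.mem_univ j)).trans
      (Finset.single_le_sum (f := fun i => ∑ j, C3 i j)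
        (fun i _ => Finset.sum_nonneg fun j _ => hC3 i j) (Finset.mem_univ i))
  have hR0 : 0 < R := by linarith
  have a1 : 0 ≤ ∑ i, 4 * C1 i ^ 2 := Finset.sum_nonneg fun i _ => by positivity
  have a2 : 0 ≤ ∑ i, C2 i := Finset.sum_nonneg fun i _ => hC2 i
  have a3 : 0 ≤ ∑ i, ∑ j, C3 i j :=
    Finset.sum_nonneg fun i _ => Finset.sum_nonneg fun j _ => hC3 i j
  set S1 := ∑ i, 4 * C1 i ^ 2
  set S2 := ∑ i, C2 i
  set S3 := ∑ i, ∑ j, C3 i j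
  have hnorm : ∀ x : E3, ‖R⁻¹ • x‖ = ‖x‖ / R := fun x => by
    rw [norm_smul, Real.norm_eq_abs, abs_of_pos (inv_pos.2 hR0)]
    ring
  have hsc : ContDiff ℝ (⊤ : ℕ∞) fun x : E3 => R⁻¹ • x := contDiff_const_smul _
  have hd1 : ∀ i x, pd i (fun x => χ (R⁻¹ • x) * χ (R⁻¹ • x)) x =
      R⁻¹ * pd i (fun x => χ x * χ x) (R⁻¹ • x) := fun i x => pd_comp_smul hχχ _ i x
  refine ⟨fun x => χ (R⁻¹ • x) * χ (R⁻¹ • x), hχχ.comp hsc, ?_, ?_, fun x => mul_self_nonneg _,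
    ?_, ?_, ?_, ?_⟩
  · intro x hx
    have : χ (R⁻¹ • x) = 0 := hχv _ (by rw [hnorm, lt_div_iff₀ hR0]; exact hx)
    simp [this]
  · intro x hx
    have : χ (R⁻¹ • x) = 1 := hχ1 _ (by rw [hnorm, div_le_one hR0]; exact hx)
    simp [this]
  · intro x
    have := (le_abs_self _).trans (h0 (R⁻¹ • x))
    linarith
  · intro i x
    rw [hd1, pd_mul hχ hχ]
    have e : R * (R⁻¹ * (pd i χ (R⁻¹ • x) * χ (R⁻¹ • x) + χ (R⁻¹ • x) * pd i χ (R⁻¹ • x))) =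
        2 * χ (R⁻¹ • x) * pd i χ (R⁻¹ • x) := by
      field_simp
      ring
    rw [e]
    have h := h1 i (R⁻¹ • x)
    have h' : (pd i χ (R⁻¹ • x)) ^ 2 ≤ C1 i ^ 2 := sq_le_sq' (abs_le.1 h).1 (abs_le.1 h).2
    have := b1 i
    nlinarith [mul_self_nonneg (χ (R⁻¹ • x))]
  · intro i x
    rw [hd1, abs_mul, abs_of_pos (inv_pos.2 hR0), inv_mul_eq_div]
    have := h2 i (R⁻¹ • x)
    have := b2 i
    gcongr
    linarith
  · intro i j x
    have e : pd i (fun x => χ (R⁻¹ • x) * χ (R⁻¹ • x)) =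
      fun x => R⁻¹ * pd i (fun x => χ x * χ x) (R⁻¹ • x) := funext fun x => hd1 i x
    have hs : ContDiff ℝ (⊤ : ℕ∞) fun x => pd i (fun x => χ x * χ x) (R⁻¹ • x) :=
      (pd_contDiff hχχ i).comp hsc
    rw [e, pd_const_mul hs, pd_comp_smul (pd_contDiff hχχ i),
      ← mul_assoc, abs_mul, abs_of_pos (by positivity), div_eq_inv_mul,
      show R⁻¹ * R⁻¹ = (R ^ 2)⁻¹ by field_simp]
    have := h3 i j (R⁻¹ • x)
    have := b3 i j
    gcongr
    linarith

/-- `ρ` is a mollification kernel supported in the unit ball, `Θ` is the potential of the radial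
field `-y ρ(y)`, and `B` bounds the derivatives of both. -/
structure RadialMollifier (Θ ρ : E3 → ℝ) (B : ℝ) : Prop where
  contDiff_potential : ContDiff ℝ (⊤ : ℕ∞) Θ
  contDiff : ContDiff ℝ (⊤ : ℕ∞) ρ
  vanishOut_potential : VanishOut 1 Θ
  vanishOut : VanishOut 1 ρ
  pd_potential : ∀ i y, pd i Θ y = -(y i * ρ y)
  integral_pos : 0 < ∫ y, ρ y
  nonneg : 0 ≤ B
  abs_pd_potential_le : ∀ i y, |pd i Θ y| ≤ B
  abs_pd_pd_potential_le : ∀ i j y, |pd j (pd i Θ) y| ≤ B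
  abs_pd_le : ∀ i y, |pd i ρ y| ≤ B
  abs_pd_pd_le : ∀ i j y, |pd j (pd i ρ) y| ≤ B

theorem exists_radialMollifier : ∃ Θ ρ B, RadialMollifier Θ ρ B := by
  obtain ⟨Θ, ρ, hΘ, hρ, hΘv, hρv, hr, hpos⟩ := exists_mollifier
  have key : ∀ f : E3 → ℝ, ContDiff ℝ (⊤ : ℕ∞) f → VanishOut 1 f → ∃ B, 0 ≤ B ∧
      (∀ i y, |pd i f y| ≤ B) ∧ ∀ i j y, |pd j (pd i f) y| ≤ B := by
    intro f hf hv
    choose C1 hC1 h1 using fun i => (hv.pd i).exists_bound (pd_contDiff hf i).continuous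
    choose C2 hC2 h2 using fun i j =>
      ((hv.pd i).pd j).exists_bound (pd_contDiff (pd_contDiff hf i) j).continuous
    have a1 : 0 ≤ ∑ i, C1 i := Finset.sum_nonneg fun i _ => hC1 i
    have a2 : 0 ≤ ∑ i, ∑ j, C2 i j :=
      Finset.sum_nonneg fun i _ => Finset.sum_nonneg fun j _ => hC2 i j
    refine ⟨∑ i, C1 i + ∑ i, ∑ j, C2 i j, by positivity, fun i y => ?_, fun i j y => ?_⟩
    · have := Finset.single_le_sum (fun i _ => hC1 i) (Finset.mem_univ i)
      linarith [h1 i y]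
    · have b1 := Finset.single_le_sum (f := fun j => C2 i j) (fun j _ => hC2 i j)
        (Finset.mem_univ j)
      have b2 := Finset.single_le_sum (f := fun i => ∑ j, C2 i j)
        (fun i _ => Finset.sum_nonneg fun j _ => hC2 i j) (Finset.mem_univ i)
      linarith [h2 i j y]
  obtain ⟨B1, hB1, h1, h2⟩ := key Θ hΘ hΘv
  obtain ⟨B2, hB2, h3, h4⟩ := key ρ hρ hρv
  exact ⟨Θ, ρ, B1 + B2, hΘ, hρ, hΘv, hρv, hr, hpos, add_nonneg hB1 hB2,
    fun i y => (h1 i y).trans (by linarith), fun i j y => (h2 i j y).trans (by linarith),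
    fun i y => (h3 i y).trans (by linarith), fun i j y => (h4 i j y).trans (by linarith)⟩
/-! ### Identities for solutions -/

section Identities

variable {U : Fin 3 → E3 → ℝ} {P : E3 → ℝ}

theorem pd_add {f g : E3 → ℝ} (hf : ContDiff ℝ (⊤ : ℕ∞) f) (hg : ContDiff ℝ (⊤ : ℕ∞) g)
    (j : Fin 3) (x : E3) :
    pd j (fun y => f y + g y) x = pd j f x + pd j g x := by
  unfold pd
  rw [fderiv_fun_add (hf.diff_top x) (hg.diff_top x)]
  rfl

theorem pd_pressure_eq (hU : ∀ i, ContDiff ℝ (⊤ : ℕ∞) (U i))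
    (hmom : ∀ i x, pd i P x = ∑ j, pd j (pd j (U i)) x - ∑ j, U j x * pd j (U i) x)
    (hdiv : ∀ x, ∑ j, pd j (U j) x = 0) (i : Fin 3) :
    pd i P = fun x => ∑ j, (pd j (pd j (U i)) x - pd j (fun y => U j y * U i y) x) := by
  funext x
  rw [hmom, Finset.sum_sub_distrib]
  have h : ∑ j, pd j (fun y => U j y * U i y) x = ∑ j, U j x * pd j (U i) x := by
    simp_rw [pd_mul (hU _) (hU i)]
    rw [Finset.sum_add_distrib, ← Finset.sum_mul, hdiv]
    ring
  rw [h]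

theorem pairing_pd_pressure (hU : ∀ i, ContDiff ℝ (⊤ : ℕ∞) (U i))
    (hmom : ∀ i x, pd i P x = ∑ j, pd j (pd j (U i)) x - ∑ j, U j x * pd j (U i) x)
    (hdiv : ∀ x, ∑ j, pd j (U j) x = 0) (s : ℝ) {b c : E3 → ℝ}
    (hb : ContDiff ℝ (⊤ : ℕ∞) b) (hc : ContDiff ℝ (⊤ : ℕ∞) c)
    (hbc : HasCompactSupport b) (hcc : HasCompactSupport c) (i : Fin 3) :
    pairing s (pd i P) b c = ∑ j, pairing s (pd j (pd j (U i))) b c -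
      ∑ j, pairing s (pd j fun y => U j y * U i y) b c := by
  have h1 : ∀ j, Continuous (pd j (pd j (U i))) := fun j =>
    (pd_contDiff (pd_contDiff (hU i) j) j).continuous
  have h2 : ∀ j, Continuous (pd j fun y => U j y * U i y) := fun j =>
    (pd_contDiff ((hU j).mul (hU i)) j).continuous
  rw [pd_pressure_eq hU hmom hdiv, pairing_sum_left Finset.univ
    (a := fun j x => pd j (pd j (U i)) x - pd j (fun y => U j y * U i y) x) s
    (fun j _ => (h1 j).sub (h2 j)) hb.continuous hc.continuous hbc hcc, ← Finset.sum_sub_distrib]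
  exact Finset.sum_congr rfl fun j _ => pairing_sub_left _ (h1 j) (h2 j)
    hb.continuous hc.continuous hbc hcc

theorem sum_pairing_lap_eq_zero (hU : ∀ i, ContDiff ℝ (⊤ : ℕ∞) (U i))
    (hdiv : ∀ x, ∑ j, pd j (U j) x = 0) (s : ℝ) {Θ c : E3 → ℝ}
    (hΘ : ContDiff ℝ (⊤ : ℕ∞) Θ) (hc : ContDiff ℝ (⊤ : ℕ∞) c)
    (hΘc : HasCompactSupport Θ) (hcc : HasCompactSupport c) :
    ∑ i, ∑ j, pairing s (pd j (pd j (U i))) (pd i Θ) c = 0 := by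
  rw [Finset.sum_comm]
  refine Finset.sum_eq_zero fun j _ => ?_
  have hΘp : ∀ i, HasCompactSupport (pd i Θ) := fun i => hΘc.fderiv_apply ℝ _
  have hcp : HasCompactSupport (pd j c) := hcc.fderiv_apply ℝ _
  have hcpp : HasCompactSupport (pd j (pd j c)) := hcp.fderiv_apply ℝ _
  have e : ∀ i, pairing s (pd j (pd j (U i))) (pd i Θ) c =
      - (s * pairing s (pd i (U i)) Θ (pd j (pd j c))) := by
    intro i
    rw [pairing_pd_right s (pd_contDiff (hU i) j) (pd_contDiff hΘ i) hc (hΘp i) hcc,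
      pairing_pd_right s (hU i) (pd_contDiff hΘ i) (pd_contDiff hc j) (hΘp i) hcp,
      pairing_pd_middle s (hU i) hΘ (pd_contDiff (pd_contDiff hc j) j) hΘc hcpp]
  simp_rw [e]
  rw [Finset.sum_neg_distrib, ← Finset.mul_sum, ← pairing_sum_left _ _
    (fun i _ => (pd_contDiff (hU i) i).continuous) hΘ.continuous
    (pd_contDiff (pd_contDiff hc j) j).continuous hΘc hcpp]
  simp_rw [hdiv]
  simp [pairing]

theorem sum_pairing_radial (hU : ∀ i, ContDiff ℝ (⊤ : ℕ∞) (U i))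
    (hmom : ∀ i x, pd i P x = ∑ j, pd j (pd j (U i)) x - ∑ j, U j x * pd j (U i) x)
    (hdiv : ∀ x, ∑ j, pd j (U j) x = 0) (s : ℝ) {Θ ρ c : E3 → ℝ}
    (hΘ : ContDiff ℝ (⊤ : ℕ∞) Θ) (hc : ContDiff ℝ (⊤ : ℕ∞) c)
    (hΘc : HasCompactSupport Θ) (hcc : HasCompactSupport c)
    (hρ : ∀ i y, pd i Θ y = -(y i * ρ y)) :
    ∑ i, pairing s (pd i P) (fun y => y i * ρ y) c =
      ∑ i, ∑ j, pairing s (pd j fun y => U j y * U i y) (pd i Θ) c := by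
  have e : ∀ i, pairing s (pd i P) (fun y => y i * ρ y) c = - pairing s (pd i P) (pd i Θ) c := by
    intro i
    unfold pairing
    rw [← integral_neg]
    congr 1
    ext w
    rw [hρ]
    ring
  simp_rw [e, pairing_pd_pressure hU hmom hdiv s (pd_contDiff hΘ _) hc
    (hΘc.fderiv_apply ℝ _ : HasCompactSupport (pd _ Θ)) hcc]
  rw [Finset.sum_neg_distrib, Finset.sum_sub_distrib,
    sum_pairing_lap_eq_zero hU hdiv s hΘ hc hΘc hcc]
  ring

theorem sum_pairing_radial_eq_right (hU : ∀ i, ContDiff ℝ (⊤ : ℕ∞) (U i))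
    (hmom : ∀ i x, pd i P x = ∑ j, pd j (pd j (U i)) x - ∑ j, U j x * pd j (U i) x)
    (hdiv : ∀ x, ∑ j, pd j (U j) x = 0) (s : ℝ) {Θ ρ c : E3 → ℝ}
    (hΘ : ContDiff ℝ (⊤ : ℕ∞) Θ) (hc : ContDiff ℝ (⊤ : ℕ∞) c)
    (hΘc : HasCompactSupport Θ) (hcc : HasCompactSupport c)
    (hρ : ∀ i y, pd i Θ y = -(y i * ρ y)) :
    ∑ i, pairing s (pd i P) (fun y => y i * ρ y) c =
      - ∑ i, ∑ j, pairing s (fun y => U j y * U i y) (pd i Θ) (pd j c) := by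
  rw [sum_pairing_radial hU hmom hdiv s hΘ hc hΘc hcc hρ]
  simp_rw [← Finset.sum_neg_distrib]
  exact Finset.sum_congr rfl fun i _ => Finset.sum_congr rfl fun j _ =>
    pairing_pd_right s ((hU j).mul (hU i)) (pd_contDiff hΘ i) hc (hΘc.fderiv_apply ℝ _) hcc j

theorem sum_pairing_radial_eq_middle (hU : ∀ i, ContDiff ℝ (⊤ : ℕ∞) (U i))
    (hmom : ∀ i x, pd i P x = ∑ j, pd j (pd j (U i)) x - ∑ j, U j x * pd j (U i) x)
    (hdiv : ∀ x, ∑ j, pd j (U j) x = 0) (s : ℝ) {Θ ρ c : E3 → ℝ}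
    (hΘ : ContDiff ℝ (⊤ : ℕ∞) Θ) (hc : ContDiff ℝ (⊤ : ℕ∞) c)
    (hΘc : HasCompactSupport Θ) (hcc : HasCompactSupport c)
    (hρ : ∀ i y, pd i Θ y = -(y i * ρ y)) :
    s * ∑ i, pairing s (pd i P) (fun y => y i * ρ y) c =
      - ∑ i, ∑ j, pairing s (fun y => U j y * U i y) (pd j (pd i Θ)) c := by
  rw [sum_pairing_radial hU hmom hdiv s hΘ hc hΘc hcc hρ, Finset.mul_sum]
  simp_rw [← Finset.sum_neg_distrib, Finset.mul_sum]
  exact Finset.sum_congr rfl fun i _ => Finset.sum_congr rfl fun j _ =>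
    pairing_pd_middle s ((hU j).mul (hU i)) (pd_contDiff hΘ i) hc (hΘc.fderiv_apply ℝ _) hcc j

theorem sq_mul_pairing_pressure (hP : ContDiff ℝ (⊤ : ℕ∞) P)
    (hU : ∀ i, ContDiff ℝ (⊤ : ℕ∞) (U i))
    (hmom : ∀ i x, pd i P x = ∑ j, pd j (pd j (U i)) x - ∑ j, U j x * pd j (U i) x)
    (hdiv : ∀ x, ∑ j, pd j (U j) x = 0) (s : ℝ) {ρ : E3 → ℝ} {V : Fin 3 → E3 → ℝ}
    (hρ : ContDiff ℝ (⊤ : ℕ∞) ρ) (hV : ∀ i, ContDiff ℝ (⊤ : ℕ∞) (V i))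
    (hρc : HasCompactSupport ρ) (hVc : ∀ i, HasCompactSupport (V i)) :
    s ^ 2 * pairing s P ρ (fun x => ∑ i, pd i (V i) x) =
      - ∑ i, ∑ j, pairing s (U i) (pd j (pd j ρ)) (V i) -
      s * ∑ i, ∑ j, pairing s (fun y => U j y * U i y) (pd j ρ) (V i) := by
  have hρp : ∀ j, HasCompactSupport (pd j ρ) := fun j => hρc.fderiv_apply ℝ _
  rw [pairing_sum_right _ _ hP.continuous hρ.continuous
    (fun i _ => (pd_contDiff (hV i) i).continuous) hρc
    (fun i _ => ((hVc i).fderiv_apply ℝ _ : HasCompactSupport (pd i (V i))))]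
  have e : ∀ i, pairing s P ρ (pd i (V i)) = - (∑ j, pairing s (pd j (pd j (U i))) ρ (V i) -
      ∑ j, pairing s (pd j fun y => U j y * U i y) ρ (V i)) := by
    intro i
    rw [← pairing_pd_pressure hU hmom hdiv s hρ (hV i) hρc (hVc i),
      pairing_pd_right s hP hρ (hV i) hρc (hVc i)]
    ring
  have e1 : ∀ i j, s ^ 2 * pairing s (pd j (pd j (U i))) ρ (V i) =
      pairing s (U i) (pd j (pd j ρ)) (V i) := by
    intro i j
    have h1 := pairing_pd_middle s (pd_contDiff (hU i) j) hρ (hV i) hρc (hVc i) j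
    have h2 := pairing_pd_middle s (hU i) (pd_contDiff hρ j) (hV i) (hρp j) (hVc i) j
    linear_combination s * h1 - h2
  have e2 : ∀ i j, s ^ 2 * pairing s (pd j fun y => U j y * U i y) ρ (V i) =
      - (s * pairing s (fun y => U j y * U i y) (pd j ρ) (V i)) := by
    intro i j
    have h1 := pairing_pd_middle s ((hU j).mul (hU i)) hρ (hV i) hρc (hVc i) j
    linear_combination s * h1
  simp_rw [e]
  rw [Finset.sum_neg_distrib, Finset.sum_sub_distrib, mul_neg, mul_sub]
  simp_rw [Finset.mul_sum, e1, e2, Finset.sum_neg_distrib]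
  ring

/-- The local energy identity. -/
theorem local_energy (hP : ContDiff ℝ (⊤ : ℕ∞) P)
    (hU : ∀ i, ContDiff ℝ (⊤ : ℕ∞) (U i))
    (hmom : ∀ i x, pd i P x = ∑ j, pd j (pd j (U i)) x - ∑ j, U j x * pd j (U i) x)
    (hdiv : ∀ x, ∑ j, pd j (U j) x = 0) {ψ : E3 → ℝ}
    (hψ : ContDiff ℝ (⊤ : ℕ∞) ψ) (hψc : HasCompactSupport ψ) :
    ∫ x, ψ x * ∑ i, ∑ j, pd j (U i) x ^ 2 =
      ∫ x, (P x * ∑ j, pd j ψ x * U j x +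
        (1 / 2 * (∑ i, U i x ^ 2) * ∑ j, pd j ψ x * U j x -
          ∑ i, ∑ j, pd j (U i) x * pd j ψ x * U i x)) := by
  have hUU : ContDiff ℝ (⊤ : ℕ∞) fun x => ∑ i, U i x * U i x :=
    ContDiff.sum fun i _ => (hU i).mul (hU i)
  have hA : ∀ j, ContDiff ℝ (⊤ : ℕ∞) fun x => ∑ i, pd j (U i) x * U i x := fun j =>
    ContDiff.sum fun i _ => (pd_contDiff (hU i) j).mul (hU i)
  let G : Fin 3 → E3 → ℝ := fun j x => ψ x * ∑ i, pd j (U i) x * U i x +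
    -(1 / 2) * ((ψ x * ∑ i, U i x * U i x) * U j x) + -1 * ((ψ x * P x) * U j x)
  have hG1 : ∀ j, ContDiff ℝ (⊤ : ℕ∞) fun x => ψ x * ∑ i, pd j (U i) x * U i x := fun j =>
    hψ.mul (hA j)
  have hG2 : ∀ j, ContDiff ℝ (⊤ : ℕ∞) fun x => (ψ x * ∑ i, U i x * U i x) * U j x := fun j =>
    (hψ.mul hUU).mul (hU j)
  have hG3 : ∀ j, ContDiff ℝ (⊤ : ℕ∞) fun x => (ψ x * P x) * U j x := fun j =>
    (hψ.mul hP).mul (hU j)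
  have hG : ∀ j, ContDiff ℝ (⊤ : ℕ∞) (G j) := fun j =>
    ((hG1 j).add (contDiff_const.mul (hG2 j))).add (contDiff_const.mul (hG3 j))
  have hGc : ∀ j, HasCompactSupport (G j) := fun j =>
    HasCompactSupport.intro hψc.isCompact fun x hx => by
      simp [G, image_eq_zero_of_notMem_tsupport hx]
  have hpdG : ∀ j x, pd j (G j) x = (pd j ψ x * (∑ i, pd j (U i) x * U i x) +
      ψ x * ∑ i, (pd j (pd j (U i)) x * U i x + pd j (U i) x * pd j (U i) x)) +
      -(1 / 2) * ((pd j ψ x * (∑ i, U i x * U i x) +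
        ψ x * ∑ i, (pd j (U i) x * U i x + U i x * pd j (U i) x)) * U j x +
        (ψ x * ∑ i, U i x * U i x) * pd j (U j) x) +
      -1 * ((pd j ψ x * P x + ψ x * pd j P x) * U j x + ψ x * P x * pd j (U j) x) := by
    intro j x
    rw [show pd j (G j) x = _ from pd_add ((hG1 j).add (contDiff_const.mul (hG2 j)))
      (contDiff_const.mul (hG3 j)) j x, pd_add (hG1 j) (contDiff_const.mul (hG2 j)),
      pd_const_mul (hG2 j), pd_const_mul (hG3 j), pd_mul hψ (hA j),
      pd_mul (hψ.mul hUU) (hU j), pd_mul hψ hUU, pd_mul (hψ.mul hP) (hU j), pd_mul hψ hP,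
      pd_sum _ (fun i _ => (hU i).mul (hU i)),
      pd_sum _ (fun i _ => (pd_contDiff (hU i) j).mul (hU i))]
    simp_rw [pd_mul (hU _) (hU _), pd_mul (pd_contDiff (hU _) j) (hU _)]
  have hpt : ∀ x, ψ x * ∑ i, ∑ j, pd j (U i) x ^ 2 = (P x * ∑ j, pd j ψ x * U j x +
      (1 / 2 * (∑ i, U i x ^ 2) * ∑ j, pd j ψ x * U j x -
        ∑ i, ∑ j, pd j (U i) x * pd j ψ x * U i x)) + ∑ j, pd j (G j) x := by
    intro x
    have hd := hdiv x
    have h0 := hmom 0 x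
    have h1 := hmom 1 x
    have h2 := hmom 2 x
    simp_rw [hpdG]
    simp only [Fin.sum_univ_three] at hd h0 h1 h2 ⊢
    linear_combination (ψ x * U 0 x) * h0 + (ψ x * U 1 x) * h1 + (ψ x * U 2 x) * h2 +
      (ψ x * P x + 1 / 2 * ψ x * (U 0 x * U 0 x + U 1 x * U 1 x + U 2 x * U 2 x)) * hd
  have hcP := hP.continuous
  have hcψ := hψ.continuous
  have hcU := fun i => (hU i).continuous
  have hcU' := fun i j => (pd_contDiff (hU i) j).continuous
  have hcψ' := fun j => (pd_contDiff hψ j).continuous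
  have hz : ∀ j x, x ∉ tsupport ψ → pd j ψ x = 0 := fun j x hx => by
    unfold pd
    rw [fderiv_of_notMem_tsupport ℝ hx]
    rfl
  simp_rw [hpt]
  rw [integral_add, integral_finsetSum]
  · have : ∀ j, ∫ x, pd j (G j) x = 0 := fun j =>
      integral_fderiv_apply_eq_zero volume ((hG j).of_le (by simp)) (hGc j) _
    simp [this]
  · exact fun j _ => (pd_contDiff (hG j) j).continuous.integrable_of_hasCompactSupport
      ((hGc j).fderiv_apply ℝ _)
  · refine Continuous.integrable_of_hasCompactSupport (by fun_prop)
      (HasCompactSupport.intro hψc.isCompact fun x hx => ?_)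
    simp [hz _ x hx]
  · exact integrable_finsetSum _ fun j _ =>
      (pd_contDiff (hG j) j).continuous.integrable_of_hasCompactSupport
      ((hGc j).fderiv_apply ℝ _)

end Identities

/-! ### Integral bounds for the pairing -/

theorem setIntegral_comp_add_le {g : E3 → ℝ} (hg : Continuous g) (hg0 : ∀ x, 0 ≤ g x) {r r' : ℝ}
    {v : E3} (hv : r + ‖v‖ ≤ r') :
    ∫ x in closedBall 0 r, g (x + v) ≤ ∫ x in closedBall 0 r', g x := by
  rw [← integral_indicator isClosed_closedBall.measurableSet,
    ← integral_indicator isClosed_closedBall.measurableSet,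
    ← integral_add_right_eq_self ((closedBall (0 : E3) r').indicator g) v]
  refine integral_mono_of_nonneg (Eventually.of_forall fun x => ?_) ?_
    (Eventually.of_forall fun x => ?_)
  · exact Set.indicator_nonneg (fun x _ => hg0 _) x
  · refine Integrable.comp_add_right (f := (closedBall (0 : E3) r').indicator g) ?_ v
    exact (hg.continuousOn.integrableOn_compact (isCompact_closedBall _ _)).integrable_indicator
      isClosed_closedBall.measurableSet
  · by_cases hx : x ∈ closedBall (0 : E3) r
    · have hx' : x + v ∈ closedBall (0 : E3) r' := by
        rw [mem_closedBall_zero_iff] at hx ⊢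
        linarith [norm_add_le x v]
      simp [Set.indicator_of_mem hx, Set.indicator_of_mem hx']
    · rw [Set.indicator_of_notMem hx]
      exact Set.indicator_nonneg (fun x _ => hg0 _) _

theorem integrableOn_prod_closedBall {F : E3 × E3 → ℝ} (hF : Continuous F) (r r' : ℝ) :
    IntegrableOn F (closedBall (0 : E3) r ×ˢ closedBall (0 : E3) r') :=
  hF.continuousOn.integrableOn_compact
    ((isCompact_closedBall _ _).prod (isCompact_closedBall _ _))

theorem setIntegral_prod_translate_le {g : E3 → ℝ} (hg : Continuous g) (hg0 : ∀ x, 0 ≤ g x)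
    {R s : ℝ} (hs0 : 0 ≤ s) (hsR : s ≤ R) :
    ∫ w in closedBall (0 : E3) (2 * R) ×ˢ closedBall (0 : E3) 1, g (w.1 + s • w.2) ≤
      volume.real (closedBall (0 : E3) 1) * ∫ x in closedBall 0 (3 * R), g x := by
  have hF : Continuous fun w : E3 × E3 => g (w.1 + s • w.2) := by fun_prop
  have hi := integrableOn_prod_closedBall hF (2 * R) 1
  rw [Measure.volume_eq_prod, ← Measure.prod_restrict]
  rw [IntegrableOn, Measure.volume_eq_prod, ← Measure.prod_restrict] at hi
  rw [integral_prod_symm _ hi]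
  have h2 : ∫ _ in closedBall (0 : E3) 1, (∫ x in closedBall (0 : E3) (3 * R), g x) =
      volume.real (closedBall (0 : E3) 1) * ∫ x in closedBall 0 (3 * R), g x := by
    rw [setIntegral_const, smul_eq_mul]
  rw [← h2]
  refine setIntegral_mono_on hi.integral_prod_right ?_ isClosed_closedBall.measurableSet
    fun y hy => setIntegral_comp_add_le hg hg0 (v := s • y) ?_
  · exact continuousOn_const.integrableOn_compact (isCompact_closedBall _ _)
  · rw [mem_closedBall_zero_iff] at hy
    rw [norm_smul, Real.norm_of_nonneg hs0]
    nlinarith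

theorem setIntegral_prod_fst_le {g : E3 → ℝ} (hg : Continuous g) (hg0 : ∀ x, 0 ≤ g x)
    {R : ℝ} (hR : 0 ≤ R) :
    ∫ w in closedBall (0 : E3) (2 * R) ×ˢ closedBall (0 : E3) 1, g w.1 ≤
      volume.real (closedBall (0 : E3) 1) * ∫ x in closedBall 0 (3 * R), g x := by
  simpa using setIntegral_prod_translate_le hg hg0 le_rfl hR

theorem abs_pairing_le_setIntegral {a b c : E3 → ℝ} {F : E3 × E3 → ℝ} {R s : ℝ}
    (hF : Continuous F) (hbv : VanishOut 1 b) (hcv : VanishOut (2 * R) c)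
    (h : ∀ x y, |c x * b y * a (x + s • y)| ≤ F (x, y)) :
    |pairing s a b c| ≤ ∫ w in closedBall (0 : E3) (2 * R) ×ˢ closedBall (0 : E3) 1, F w := by
  have e : pairing s a b c = ∫ w in closedBall (0 : E3) (2 * R) ×ˢ closedBall (0 : E3) 1,
      c w.1 * b w.2 * a (w.1 + s • w.2) := by
    refine (setIntegral_eq_integral_of_forall_compl_eq_zero fun w hw => ?_).symm
    rw [Set.mem_prod, not_and_or, mem_closedBall_zero_iff, mem_closedBall_zero_iff] at hw
    rcases hw with hw | hw
    · simp [hcv _ (not_le.1 hw)]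
    · simp [hbv _ (not_le.1 hw)]
  rw [e, ← Real.norm_eq_abs]
  exact norm_integral_le_of_norm_le (integrableOn_prod_closedBall hF _ _)
    (Eventually.of_forall fun w => h w.1 w.2)

theorem abs_pairing_le {a b c g : E3 → ℝ} {R s k : ℝ} (hg : Continuous g) (hg0 : ∀ x, 0 ≤ g x)
    (hs0 : 0 ≤ s) (hsR : s ≤ R) (hk : 0 ≤ k) (hbv : VanishOut 1 b) (hcv : VanishOut (2 * R) c)
    (h : ∀ x y, |c x * b y * a (x + s • y)| ≤ k * (g x + g (x + s • y))) :
    |pairing s a b c| ≤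
      2 * volume.real (closedBall (0 : E3) 1) * k * ∫ x in closedBall 0 (3 * R), g x := by
  have hF1 : Continuous fun w : E3 × E3 => g w.1 := by fun_prop
  have hF2 : Continuous fun w : E3 × E3 => g (w.1 + s • w.2) := by fun_prop
  refine (abs_pairing_le_setIntegral (F := fun w => k * (g w.1 + g (w.1 + s • w.2)))
    (by fun_prop) hbv hcv h).trans ?_
  rw [integral_const_mul, integral_add (integrableOn_prod_closedBall hF1 _ _)
    (integrableOn_prod_closedBall hF2 _ _)]
  have h1 := setIntegral_prod_fst_le hg hg0 (hs0.trans hsR)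
  have h2 := setIntegral_prod_translate_le hg hg0 hs0 hsR
  calc _ ≤ k * (_ + _) := mul_le_mul_of_nonneg_left (add_le_add h1 h2) hk
    _ = _ := by ring

theorem setIntegral_comp_smul_le {g : E3 → ℝ} (hg : Continuous g) (hg0 : ∀ x, 0 ≤ g x)
    {R s : ℝ} (hs0 : 0 < s) (hsR : s ≤ R) {x : E3} (hx : ‖x‖ ≤ 2 * R) :
    ∫ y in closedBall (0 : E3) 1, g (x + s • y) ≤
      (s ^ 3)⁻¹ * ∫ z in closedBall 0 (3 * R), g z := by
  have h := Measure.setIntegral_comp_smul_of_pos (volume : Measure E3) (fun z => g (x + z))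
    (closedBall (0 : E3) 1) hs0
  rw [h, finrank_euclideanSpace_fin, smul_eq_mul, _root_.smul_closedBall _ _ zero_le_one, smul_zero,
    Real.norm_of_nonneg hs0.le, mul_one]
  simp_rw [add_comm x]
  gcongr
  exact setIntegral_comp_add_le hg hg0 (by linarith)

theorem setIntegral_comp_smul_le_of_cube {a : E3 → ℝ} (ha : Continuous a) (ha0 : ∀ x, 0 ≤ a x)
    {R s K : ℝ} (hs0 : 0 < s) (hs1 : s ≤ 1) (hR : 1 ≤ R)
    (hK : ∫ z in closedBall 0 (3 * R), a z ^ 3 ≤ K * R) {x : E3} (hx : ‖x‖ ≤ 2 * R) :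
    ∫ y in closedBall (0 : E3) 1, a (x + s • y) ≤
      (K + volume.real (closedBall (0 : E3) 1)) * (R / s) := by
  have hR0 : 0 < R := by linarith
  have h1 := setIntegral_comp_smul_le (g := fun x => a x ^ 3) (ha.pow 3) (fun x => pow_nonneg (ha0 x) 3) hs0
    (hs1.trans hR) hx
  have hK0 : 0 ≤ K := by
    have : 0 ≤ ∫ z in closedBall (0 : E3) (3 * R), a z ^ 3 :=
      integral_nonneg fun z => pow_nonneg (ha0 z) 3
    by_contra hK'
    nlinarith [mul_pos (neg_pos.2 (not_le.1 hK')) hR0]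
  have hpt : ∀ t : ℝ, 0 ≤ t → t ≤ (R / s)⁻¹ ^ 2 * t ^ 3 + R / s := by
    intro t ht
    have hk : 0 < R / s := by positivity
    rcases le_total t (R / s) with h | h
    · have : 0 ≤ (R / s)⁻¹ ^ 2 * t ^ 3 := by positivity
      linarith
    · have : 1 ≤ (R / s)⁻¹ * t := by rwa [inv_mul_eq_div, one_le_div hk]
      nlinarith [mul_le_mul this this zero_le_one (by positivity)]
  have hc1 : Continuous fun y : E3 => a (x + s • y) := by fun_prop
  have hc2 : Continuous fun y : E3 => a (x + s • y) ^ 3 := by fun_prop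
  have hi : ∀ {f : E3 → ℝ}, Continuous f → IntegrableOn f (closedBall (0 : E3) 1) := fun hf =>
    hf.continuousOn.integrableOn_compact (isCompact_closedBall _ _)
  calc ∫ y in closedBall (0 : E3) 1, a (x + s • y)
      ≤ ∫ y in closedBall (0 : E3) 1, ((R / s)⁻¹ ^ 2 * a (x + s • y) ^ 3 + R / s) :=
        setIntegral_mono (hi hc1) (hi (by fun_prop)) fun y => hpt _ (ha0 _)
    _ = (R / s)⁻¹ ^ 2 * (∫ y in closedBall (0 : E3) 1, a (x + s • y) ^ 3) +
          volume.real (closedBall (0 : E3) 1) * (R / s) := by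
        rw [integral_add (hi (by fun_prop)) (hi (by fun_prop)), integral_const_mul,
          setIntegral_const, smul_eq_mul]
    _ ≤ (R / s)⁻¹ ^ 2 * ((s ^ 3)⁻¹ * (K * R)) + volume.real (closedBall (0 : E3) 1) * (R / s) := by
        gcongr
        exact h1.trans (by gcongr)
    _ = K * (R / s) * (R⁻¹) ^ 2 + volume.real (closedBall (0 : E3) 1) * (R / s) := by
        field_simp
    _ ≤ _ := by
        have : (R⁻¹) ^ 2 ≤ 1 := pow_le_one₀ (by positivity) (inv_le_one_of_one_le₀ hR)
        have h3 : 0 ≤ K * (R / s) := by positivity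
        nlinarith

/-- Weighted bound for the pairing of a quadratic quantity. -/
theorem abs_pairing_le_weighted {a A b c : E3 → ℝ} {R s K B τ : ℝ} (ha : Continuous a)
    (ha0 : ∀ x, 0 ≤ a x) (hA : ∀ x, |A x| ≤ a x ^ 2) (hc : Continuous c)
    (hbB : ∀ y, |b y| ≤ B) (hbv : VanishOut 1 b) (hcv : VanishOut (2 * R) c)
    (hs0 : 0 < s) (hs1 : s ≤ 1) (hR : 1 ≤ R) (hτ : 0 < τ)
    (hK : ∫ z in closedBall 0 (3 * R), a z ^ 3 ≤ K * R) :
    |pairing s A b c| ≤ B * (τ * ((K + volume.real (closedBall (0 : E3) 1)) * (R / s) *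
      ∫ x in closedBall 0 (2 * R), c x ^ 2) +
      τ⁻¹ * (volume.real (closedBall (0 : E3) 1) * ∫ x in closedBall 0 (3 * R), a x ^ 3)) := by
  have hB : 0 ≤ B := (abs_nonneg _).trans (hbB 0)
  have hF1 : Continuous fun w : E3 × E3 => c w.1 ^ 2 * a (w.1 + s • w.2) := by fun_prop
  have hF2 : Continuous fun w : E3 × E3 => a (w.1 + s • w.2) ^ 3 := by fun_prop
  refine (abs_pairing_le_setIntegral (F := fun w => B * (τ * (c w.1 ^ 2 * a (w.1 + s • w.2)) +
    τ⁻¹ * a (w.1 + s • w.2) ^ 3)) (by fun_prop) hbv hcv fun x y => ?_).trans ?_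
  · rw [abs_mul, abs_mul, mul_comm |c x|, mul_assoc]
    have h0 := ha0 (x + s • y)
    have hab : |c x| * a (x + s • y) ^ 2 ≤
        τ * (c x ^ 2 * a (x + s • y)) + τ⁻¹ * a (x + s • y) ^ 3 := by
      have h2 : |c x| * a (x + s • y) ≤ τ * c x ^ 2 + τ⁻¹ * a (x + s • y) ^ 2 := by
        have h3 : τ * c x ^ 2 + τ⁻¹ * a (x + s • y) ^ 2 - |c x| * a (x + s • y) =
            τ⁻¹ * ((τ * |c x| - a (x + s • y)) ^ 2 + τ * |c x| * a (x + s • y)) := by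
          rw [← sq_abs (c x)]
          field_simp
          ring
        have : 0 ≤ τ⁻¹ * ((τ * |c x| - a (x + s • y)) ^ 2 + τ * |c x| * a (x + s • y)) := by
          positivity
        linarith
      calc |c x| * a (x + s • y) ^ 2 = |c x| * a (x + s • y) * a (x + s • y) := by ring
        _ ≤ _ := mul_le_mul_of_nonneg_right h2 h0
        _ = _ := by ring
    have hA' := hA (x + s • y)
    have hb' := hbB y
    calc |b y| * (|c x| * |A (x + s • y)|) ≤ B * (|c x| * a (x + s • y) ^ 2) := by gcongr
      _ ≤ _ := by gcongr
  · rw [integral_const_mul]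
    refine mul_le_mul_of_nonneg_left ?_ hB
    rw [integral_add ((integrableOn_prod_closedBall hF1 _ _).const_mul τ)
      ((integrableOn_prod_closedBall hF2 _ _).const_mul _), integral_const_mul, integral_const_mul]
    refine add_le_add (mul_le_mul_of_nonneg_left ?_ hτ.le)
      (mul_le_mul_of_nonneg_left (setIntegral_prod_translate_le
        (g := fun x => a x ^ 3) (ha.pow 3) (fun x => pow_nonneg (ha0 x) 3) hs0.le (hs1.trans hR)) (by positivity))
    have hi := integrableOn_prod_closedBall hF1 (2 * R) 1
    rw [Measure.volume_eq_prod, ← Measure.prod_restrict]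
    rw [IntegrableOn, Measure.volume_eq_prod, ← Measure.prod_restrict] at hi
    rw [integral_prod _ hi, ← integral_const_mul]
    refine setIntegral_mono_on hi.integral_prod_left ?_ isClosed_closedBall.measurableSet
      fun x hx => ?_
    · exact (continuous_const.mul (hc.pow 2)).continuousOn.integrableOn_compact
        (isCompact_closedBall _ _)
    · dsimp only
      rw [integral_const_mul, mul_comm]
      exact mul_le_mul_of_nonneg_right (setIntegral_comp_smul_le_of_cube ha ha0 hs0 hs1 hR hK
        (by simpa using hx)) (sq_nonneg _)

/-! ### Quantitative bounds at a fixed scale -/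

/-- A smooth solution of the stationary Navier–Stokes equations, written componentwise. -/
structure SmoothNS (U : Fin 3 → E3 → ℝ) (P : E3 → ℝ) : Prop where
  contDiff : ∀ i, ContDiff ℝ (⊤ : ℕ∞) (U i)
  contDiff_pressure : ContDiff ℝ (⊤ : ℕ∞) P
  momentum : ∀ i x, pd i P x = ∑ j, pd j (pd j (U i)) x - ∑ j, U j x * pd j (U i) x
  div_eq_zero : ∀ x, ∑ j, pd j (U j) x = 0

/-- The pointwise Euclidean length of a vector field given by its components. -/
def speed (U : Fin 3 → E3 → ℝ) (x : E3) : ℝ := Real.sqrt (∑ i, U i x ^ 2)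

/-- The volume of the unit ball. -/
def unitVol : ℝ := volume.real (closedBall (0 : E3) 1)

/-- The scale-invariant cubic quantity on the ball of radius `3R`, with a lower order term. -/
def cubicMean (U : Fin 3 → E3 → ℝ) (R : ℝ) : ℝ :=
  ((∫ x in closedBall 0 (3 * R), speed U x ^ 3) + 1) / R

/-- The localized Dirichlet energy. -/
def localEnergy (U : Fin 3 → E3 → ℝ) (ψ : E3 → ℝ) : ℝ :=
  ∫ x, ψ x * ∑ i, ∑ j, pd j (U i) x ^ 2

/-- The divergence of the localized velocity field. -/
def divCut (U : Fin 3 → E3 → ℝ) (ψ : E3 → ℝ) (x : E3) : ℝ :=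
  ∑ i, pd i (fun y => ψ y * U i y) x

theorem unitVol_nonneg : 0 ≤ unitVol := measureReal_nonneg

theorem speed_nonneg (U : Fin 3 → E3 → ℝ) (x : E3) : 0 ≤ speed U x := Real.sqrt_nonneg _

theorem speed_sq (U : Fin 3 → E3 → ℝ) (x : E3) : speed U x ^ 2 = ∑ i, U i x ^ 2 :=
  Real.sq_sqrt (Finset.sum_nonneg fun _ _ => sq_nonneg _)

theorem abs_le_speed (U : Fin 3 → E3 → ℝ) (i : Fin 3) (x : E3) : |U i x| ≤ speed U x := by
  refine Real.abs_le_sqrt ?_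
  exact Finset.single_le_sum (f := fun i => U i x ^ 2) (fun _ _ => sq_nonneg _) (Finset.mem_univ i)

theorem abs_mul_le_speed_sq (U : Fin 3 → E3 → ℝ) (i j : Fin 3) (x : E3) :
    |U j x * U i x| ≤ speed U x ^ 2 := by
  rw [abs_mul, sq]
  exact mul_le_mul (abs_le_speed U j x) (abs_le_speed U i x) (abs_nonneg _) (speed_nonneg U x)

theorem speed_continuous {U : Fin 3 → E3 → ℝ} (hU : ∀ i, Continuous (U i)) :
    Continuous (speed U) := by
  unfold speed
  fun_prop

theorem setIntegral_speed_cube_nonneg (U : Fin 3 → E3 → ℝ) (r : ℝ) :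
    0 ≤ ∫ x in closedBall 0 r, speed U x ^ 3 :=
  integral_nonneg fun x => pow_nonneg (speed_nonneg U x) 3

theorem cubicMean_nonneg (U : Fin 3 → E3 → ℝ) {R : ℝ} (hR : 0 ≤ R) : 0 ≤ cubicMean U R := by
  have := setIntegral_speed_cube_nonneg U (3 * R)
  unfold cubicMean
  positivity

theorem setIntegral_speed_cube_div_le (U : Fin 3 → E3 → ℝ) {R : ℝ} (hR : 0 ≤ R) :
    (∫ x in closedBall 0 (3 * R), speed U x ^ 3) / R ≤ cubicMean U R := by
  unfold cubicMean
  gcongr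
  linarith

theorem setIntegral_speed_sq_div_le {U : Fin 3 → E3 → ℝ} (hU : ∀ i, Continuous (U i)) {R : ℝ}
    (hR : 1 ≤ R) : (∫ x in closedBall 0 (3 * R), speed U x ^ 2) / R ^ 2 ≤
      (1 + 27 * unitVol) * cubicMean U R := by
  have hR0 : 0 < R := by linarith
  have hc := speed_continuous hU
  have hi : ∀ {f : E3 → ℝ}, Continuous f → IntegrableOn f (closedBall (0 : E3) (3 * R)) :=
    fun hf => hf.continuousOn.integrableOn_compact (isCompact_closedBall _ _)
  have hM := setIntegral_speed_cube_nonneg U (3 * R)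
  have hv := unitVol_nonneg
  have hpt : ∀ x, speed U x ^ 2 ≤ R * speed U x ^ 3 + (R ^ 2)⁻¹ := by
    intro x
    have ht := speed_nonneg U x
    set t := speed U x
    have h1 : (R * t) ^ 2 ≤ (R * t) ^ 3 + 1 := by
      have : 0 ≤ R * t := by positivity
      rcases le_total (R * t) 1 with h | h
      · nlinarith [pow_nonneg this 3]
      · nlinarith [mul_nonneg (sq_nonneg (R * t)) (sub_nonneg.2 h)]
    have h2 : t ^ 2 = (R * t) ^ 2 * (R ^ 2)⁻¹ := by field_simp
    have h3 : R * t ^ 3 + (R ^ 2)⁻¹ = ((R * t) ^ 3 + 1) * (R ^ 2)⁻¹ := by field_simp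
    rw [h2, h3]
    gcongr
  have hint := setIntegral_mono (μ := volume) (s := closedBall (0 : E3) (3 * R))
    (f := fun x => speed U x ^ 2) (g := fun x => R * speed U x ^ 3 + (R ^ 2)⁻¹)
    (hi (by fun_prop)) (hi (by fun_prop)) hpt
  rw [integral_add (hi (by fun_prop)) (hi (by fun_prop)),
    integral_const_mul, setIntegral_const, smul_eq_mul,
    Measure.addHaar_real_closedBall' _ _ (by positivity), finrank_euclideanSpace_fin] at hint
  change _ ≤ _ + (3 * R) ^ 3 * unitVol * (R ^ 2)⁻¹ at hint
  unfold cubicMean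
  set M := ∫ x in closedBall 0 (3 * R), speed U x ^ 3
  calc (∫ x in closedBall 0 (3 * R), speed U x ^ 2) / R ^ 2
      ≤ (R * M + (3 * R) ^ 3 * unitVol * (R ^ 2)⁻¹) / R ^ 2 := by gcongr
    _ = (M + 27 * unitVol) / R := by field_simp; ring
    _ ≤ ((1 + 27 * unitVol) * (M + 1)) / R := by
        gcongr
        nlinarith [mul_nonneg hv hM]
    _ = _ := by ring

section Scale

variable {U : Fin 3 → E3 → ℝ} {P ψ Θ ρ : E3 → ℝ} {B C R : ℝ}

theorem ScaledCutoff.const_nonneg (h : ScaledCutoff C R ψ) : 0 ≤ C :=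
  (h.nonneg 0).trans (h.le 0)

theorem ScaledCutoff.localEnergy_nonneg (h : ScaledCutoff C R ψ) : 0 ≤ localEnergy U ψ :=
  integral_nonneg fun x => mul_nonneg (h.nonneg x)
    (Finset.sum_nonneg fun _ _ => Finset.sum_nonneg fun _ _ => sq_nonneg _)

theorem divCut_contDiff (hU : ∀ i, ContDiff ℝ (⊤ : ℕ∞) (U i)) (h : ContDiff ℝ (⊤ : ℕ∞) ψ) :
    ContDiff ℝ (⊤ : ℕ∞) (divCut U ψ) :=
  ContDiff.sum fun i _ => pd_contDiff (h.mul (hU i)) i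

theorem divCut_vanishOut {r : ℝ} (h : VanishOut r ψ) : VanishOut r (divCut U ψ) :=
  VanishOut.sum fun i _ => (h.mul_right (U i)).pd i

theorem divCut_eq (hNS : SmoothNS U P) (h : ContDiff ℝ (⊤ : ℕ∞) ψ) :
    divCut U ψ = fun x => ∑ i, pd i ψ x * U i x := by
  funext x
  unfold divCut
  simp_rw [pd_mul h (hNS.contDiff _)]
  rw [Finset.sum_add_distrib, ← Finset.mul_sum, hNS.div_eq_zero]
  ring

theorem ScaledCutoff.abs_divCut_le (h : ScaledCutoff C R ψ) (hNS : SmoothNS U P) (hR : 0 < R)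
    (x : E3) : |divCut U ψ x| ≤ 3 * C / R * speed U x := by
  have hC := h.const_nonneg
  rw [divCut_eq hNS h.contDiff]
  refine (Finset.abs_sum_le_sum_abs _ _).trans ?_
  calc ∑ i, |pd i ψ x * U i x| ≤ ∑ _i : Fin 3, C / R * speed U x :=
        Finset.sum_le_sum fun i _ => by
          rw [abs_mul]
          exact mul_le_mul (h.abs_pd_le i x) (abs_le_speed U i x) (abs_nonneg _) (by positivity)
    _ = _ := by
        rw [Finset.sum_const, Finset.card_univ, Fintype.card_fin, nsmul_eq_mul]
        push_cast
        ring

theorem ScaledCutoff.sq_pd_divCut_le (h : ScaledCutoff C R ψ) (hNS : SmoothNS U P) (hR : 0 < R)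
    (j : Fin 3) (x : E3) : pd j (divCut U ψ) x ^ 2 ≤ 6 * (C ^ 2 / R ^ 4 * speed U x ^ 2 +
      C / R ^ 2 * (ψ x * ∑ i, ∑ j, pd j (U i) x ^ 2)) := by
  have hC := h.const_nonneg
  have hψ0 := h.nonneg x
  rw [divCut_eq hNS h.contDiff,
    pd_sum _ fun i _ => (pd_contDiff h.contDiff i).mul (hNS.contDiff i)]
  simp_rw [pd_mul (pd_contDiff h.contDiff _) (hNS.contDiff _)]
  have h1 : ∀ i, (pd j (pd i ψ) x * U i x + pd i ψ x * pd j (U i) x) ^ 2 ≤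
      2 * (C ^ 2 / R ^ 4 * U i x ^ 2 + C / R ^ 2 * (ψ x * ∑ j, pd j (U i) x ^ 2)) := by
    intro i
    have e1 : pd j (pd i ψ) x ^ 2 ≤ C ^ 2 / R ^ 4 := by
      rw [← sq_abs, show C ^ 2 / R ^ 4 = (C / R ^ 2) ^ 2 by ring]
      gcongr
      exact h.abs_pd_pd_le i j x
    have e2 : pd i ψ x ^ 2 ≤ C / R ^ 2 * ψ x := by
      have := h.sq_pd_le i x
      rw [div_mul_eq_mul_div, le_div_iff₀ (by positivity)]
      linarith [mul_pow R (pd i ψ x) 2]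
    have e3 : pd j (U i) x ^ 2 ≤ ∑ j, pd j (U i) x ^ 2 :=
      Finset.single_le_sum (f := fun j => pd j (U i) x ^ 2) (fun _ _ => sq_nonneg _)
        (Finset.mem_univ j)
    calc (pd j (pd i ψ) x * U i x + pd i ψ x * pd j (U i) x) ^ 2
        ≤ 2 * (pd j (pd i ψ) x ^ 2 * U i x ^ 2 + pd i ψ x ^ 2 * pd j (U i) x ^ 2) := by
          nlinarith [sq_nonneg (pd j (pd i ψ) x * U i x - pd i ψ x * pd j (U i) x)]
      _ ≤ 2 * (C ^ 2 / R ^ 4 * U i x ^ 2 + C / R ^ 2 * ψ x * ∑ j, pd j (U i) x ^ 2) := by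
          gcongr
      _ = _ := by ring
  calc (∑ i, (pd j (pd i ψ) x * U i x + pd i ψ x * pd j (U i) x)) ^ 2
      ≤ 3 * ∑ i, (pd j (pd i ψ) x * U i x + pd i ψ x * pd j (U i) x) ^ 2 := by
        have := sq_sum_le_card_mul_sum_sq (s := (Finset.univ : Finset (Fin 3)))
          (f := fun i => pd j (pd i ψ) x * U i x + pd i ψ x * pd j (U i) x)
        simpa using this
    _ ≤ 3 * ∑ i, 2 * (C ^ 2 / R ^ 4 * U i x ^ 2 + C / R ^ 2 * (ψ x * ∑ j, pd j (U i) x ^ 2)) := by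
        gcongr with i
        exact h1 i
    _ = _ := by
        rw [speed_sq, ← Finset.mul_sum, Finset.sum_add_distrib, ← Finset.mul_sum,
          ← Finset.mul_sum, ← Finset.mul_sum]
        ring

theorem ScaledCutoff.setIntegral_sq_pd_divCut_le (h : ScaledCutoff C R ψ) (hNS : SmoothNS U P)
    (hR : 1 ≤ R) (j : Fin 3) :
    R ^ 2 * ∫ x in closedBall 0 (2 * R), pd j (divCut U ψ) x ^ 2 ≤
      6 * (C ^ 2 * ((1 + 27 * unitVol) * cubicMean U R) + C * localEnergy U ψ) := by
  have hR0 : 0 < R := by linarith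
  have hC := h.const_nonneg
  have hcU := fun i => (hNS.contDiff i).continuous
  have hcU' := fun i j => (pd_contDiff (hNS.contDiff i) j).continuous
  have hcψ := h.contDiff.continuous
  have hca := speed_continuous hcU
  have hcd := (pd_contDiff (divCut_contDiff hNS.contDiff h.contDiff) j).continuous
  have hi : ∀ {f : E3 → ℝ}, Continuous f → ∀ r, IntegrableOn f (closedBall (0 : E3) r) :=
    fun hf r => hf.continuousOn.integrableOn_compact (isCompact_closedBall _ _)
  have hint := setIntegral_mono (μ := volume) (s := closedBall (0 : E3) (2 * R))
    (hi (hcd.pow 2) _) (hi (by fun_prop) _) (h.sq_pd_divCut_le hNS hR0 j)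
  rw [integral_const_mul, integral_add (hi (by fun_prop) _) (hi (by fun_prop) _),
    integral_const_mul, integral_const_mul] at hint
  have h1 : ∫ x in closedBall 0 (2 * R), ψ x * ∑ i, ∑ j, pd j (U i) x ^ 2 = localEnergy U ψ :=
    setIntegral_eq_integral_of_forall_compl_eq_zero fun x hx => by
      rw [h.vanishOut x (by simpa using hx), zero_mul]
  have h2 : ∫ x in closedBall 0 (2 * R), speed U x ^ 2 ≤
      ∫ x in closedBall 0 (3 * R), speed U x ^ 2 :=
    setIntegral_mono_set (hi (hca.pow 2) _) (Eventually.of_forall fun x => sq_nonneg _)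
      (closedBall_subset_closedBall (by linarith)).eventuallyLE
  have h3 := setIntegral_speed_sq_div_le hcU hR
  rw [h1] at hint
  set N := ∫ x in closedBall 0 (3 * R), speed U x ^ 2
  calc R ^ 2 * ∫ x in closedBall 0 (2 * R), pd j (divCut U ψ) x ^ 2
      ≤ R ^ 2 * (6 * (C ^ 2 / R ^ 4 * N + C / R ^ 2 * localEnergy U ψ)) := by
        gcongr
        refine hint.trans ?_
        gcongr
    _ = 6 * (C ^ 2 * (N / R ^ 2) + C * localEnergy U ψ) := by field_simp
    _ ≤ _ := by gcongr

theorem mul_sq_le_cube_add_cube {a b : ℝ} (ha : 0 ≤ a) (hb : 0 ≤ b) :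
    a * b ^ 2 ≤ a ^ 3 + b ^ 3 := by
  nlinarith [mul_nonneg (add_nonneg ha hb) (sq_nonneg (a - b)), mul_nonneg (sq_nonneg a) hb,
    pow_nonneg ha 3, pow_nonneg hb 3]

theorem abs_sum_sum_le {F : Fin 3 → Fin 3 → ℝ} {D : ℝ} (h : ∀ i j, |F i j| ≤ D) :
    |∑ i, ∑ j, F i j| ≤ 9 * D := by
  refine (Finset.abs_sum_le_sum_abs _ _).trans ?_
  calc ∑ i, |∑ j, F i j| ≤ ∑ _i : Fin 3, ∑ _j : Fin 3, D := Finset.sum_le_sum fun i _ =>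
        (Finset.abs_sum_le_sum_abs _ _).trans (Finset.sum_le_sum fun j _ => h i j)
    _ = 9 * D := by
        simp
        ring

/-- The mollified pressure term at the scale of the cutoff. -/
theorem abs_pairing_pressure_le (hNS : SmoothNS U P) (h : ScaledCutoff C R ψ)
    (hm : RadialMollifier Θ ρ B) (hR : 1 ≤ R) :
    |pairing R P ρ (divCut U ψ)| ≤ 18 * unitVol * (C * B) * (2 + 27 * unitVol) * cubicMean U R := by
  have hR0 : 0 < R := by linarith
  have hC := h.const_nonneg
  have hB := hm.nonneg
  have hv := unitVol_nonneg
  have hcU := fun i => (hNS.contDiff i).continuous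
  have hca := speed_continuous hcU
  have e := sq_mul_pairing_pressure hNS.contDiff_pressure hNS.contDiff hNS.momentum
    hNS.div_eq_zero R (V := fun i y => ψ y * U i y) hm.contDiff
    (fun i => h.contDiff.mul (hNS.contDiff i)) hm.vanishOut.hasCompactSupport
    (fun i => (h.vanishOut.mul_right _).hasCompactSupport)
  change R ^ 2 * pairing R P ρ (divCut U ψ) = _ at e
  set M := ∫ x in closedBall 0 (3 * R), speed U x ^ 3 with hM
  set N := ∫ x in closedBall 0 (3 * R), speed U x ^ 2 with hN
  have hV : ∀ i x, |ψ x * U i x| ≤ C * speed U x := fun i x => by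
    rw [abs_mul, abs_of_nonneg (h.nonneg x)]
    exact mul_le_mul (h.le x) (abs_le_speed U i x) (abs_nonneg _) hC
  have b1 : |∑ i, ∑ j, pairing R (U i) (pd j (pd j ρ)) (fun y => ψ y * U i y)| ≤
      9 * (2 * unitVol * (C * B) * N) := by
    refine abs_sum_sum_le fun i j => abs_pairing_le (g := fun x => speed U x ^ 2) (hca.pow 2)
      (fun x => sq_nonneg _) hR0.le le_rfl (by positivity) ((hm.vanishOut.pd j).pd j)
      (h.vanishOut.mul_right _) fun x y => ?_
    rw [abs_mul, abs_mul]
    have h1 := speed_nonneg U x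
    have h2 := speed_nonneg U (x + R • y)
    calc |ψ x * U i x| * |pd j (pd j ρ) y| * |U i (x + R • y)|
        ≤ C * speed U x * B * speed U (x + R • y) := by
          gcongr
          · exact hV i x
          · exact hm.abs_pd_pd_le j j y
          · exact abs_le_speed U i _
      _ = C * B * (speed U x * speed U (x + R • y)) := by ring
      _ ≤ _ := by
          gcongr
          nlinarith [sq_nonneg (speed U x - speed U (x + R • y))]
  have b2 : |∑ i, ∑ j, pairing R (fun y => U j y * U i y) (pd j ρ) (fun y => ψ y * U i y)| ≤
      9 * (2 * unitVol * (C * B) * M) := by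
    refine abs_sum_sum_le fun i j => abs_pairing_le (g := fun x => speed U x ^ 3) (hca.pow 3)
      (fun x => pow_nonneg (speed_nonneg U x) 3) hR0.le le_rfl (by positivity)
      (hm.vanishOut.pd j) (h.vanishOut.mul_right _) fun x y => ?_
    rw [abs_mul, abs_mul]
    have h1 := speed_nonneg U x
    have h2 := speed_nonneg U (x + R • y)
    calc |ψ x * U i x| * |pd j ρ y| * |U j (x + R • y) * U i (x + R • y)|
        ≤ C * speed U x * B * speed U (x + R • y) ^ 2 := by
          gcongr
          · exact hV i x
          · exact hm.abs_pd_le j y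
          · exact abs_mul_le_speed_sq U i j _
      _ = C * B * (speed U x * speed U (x + R • y) ^ 2) := by ring
      _ ≤ _ := by
          gcongr
          exact mul_sq_le_cube_add_cube h1 h2
  have h3 := setIntegral_speed_sq_div_le hcU hR
  have h4 := setIntegral_speed_cube_div_le U hR0.le
  rw [← hN] at h3
  rw [← hM] at h4
  have e' : pairing R P ρ (divCut U ψ) = (R ^ 2 * pairing R P ρ (divCut U ψ)) / R ^ 2 := by
    field_simp
  rw [e', e, abs_div, abs_of_pos (by positivity : 0 < R ^ 2)]
  calc _ ≤ (9 * (2 * unitVol * (C * B) * N) + R * (9 * (2 * unitVol * (C * B) * M))) / R ^ 2 := by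
        gcongr
        refine (abs_sub _ _).trans ?_
        rw [abs_neg, abs_mul, abs_of_pos hR0]
        gcongr
    _ = 18 * unitVol * (C * B) * (N / R ^ 2 + M / R) := by field_simp; ring
    _ ≤ 18 * unitVol * (C * B) * ((1 + 27 * unitVol) * cubicMean U R + cubicMean U R) := by gcongr
    _ = _ := by ring

/-- The derivative of the mollified pressure term in the mollification scale. -/
theorem mul_abs_sum_pairing_radial_le (hNS : SmoothNS U P) (h : ScaledCutoff C R ψ)
    (hm : RadialMollifier Θ ρ B) {s : ℝ} (hs : 0 ≤ s) (hsR : s ≤ R) (hR : 1 ≤ R) :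
    |s * ∑ i, pairing s (pd i P) (fun y => y i * ρ y) (divCut U ψ)| ≤
      54 * unitVol * (C * B) * cubicMean U R := by
  have hR0 : 0 < R := by linarith
  have hC := h.const_nonneg
  have hB := hm.nonneg
  have hv := unitVol_nonneg
  have hca := speed_continuous fun i => (hNS.contDiff i).continuous
  rw [sum_pairing_radial_eq_middle hNS.contDiff hNS.momentum hNS.div_eq_zero s
    hm.contDiff_potential (divCut_contDiff hNS.contDiff h.contDiff)
    hm.vanishOut_potential.hasCompactSupport (divCut_vanishOut h.vanishOut).hasCompactSupport
    hm.pd_potential, abs_neg]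
  have h4 := setIntegral_speed_cube_div_le U hR0.le
  calc _ ≤ 9 * (2 * unitVol * (3 * C / R * B) * ∫ x in closedBall 0 (3 * R), speed U x ^ 3) := by
        refine abs_sum_sum_le fun i j => abs_pairing_le (g := fun x => speed U x ^ 3) (hca.pow 3)
          (fun x => pow_nonneg (speed_nonneg U x) 3) hs hsR (by positivity)
          ((hm.vanishOut_potential.pd i).pd j) (divCut_vanishOut h.vanishOut) fun x y => ?_
        rw [abs_mul, abs_mul]
        have h1 := speed_nonneg U x
        have h2 := speed_nonneg U (x + s • y)
        calc |divCut U ψ x| * |pd j (pd i Θ) y| * |U j (x + s • y) * U i (x + s • y)|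
            ≤ 3 * C / R * speed U x * B * speed U (x + s • y) ^ 2 := by
              gcongr
              · exact h.abs_divCut_le hNS hR0 x
              · exact hm.abs_pd_pd_potential_le i j y
              · exact abs_mul_le_speed_sq U i j _
          _ = 3 * C / R * B * (speed U x * speed U (x + s • y) ^ 2) := by ring
          _ ≤ _ := by
              gcongr
              exact mul_sq_le_cube_add_cube h1 h2
    _ = 54 * unitVol * (C * B) * ((∫ x in closedBall 0 (3 * R), speed U x ^ 3) / R) := by ring
    _ ≤ _ := by gcongr

theorem abs_sum_pairing_radial_le (hNS : SmoothNS U P) (h : ScaledCutoff C R ψ)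
    (hm : RadialMollifier Θ ρ B) {σ ε K : ℝ} (hσ : 0 < σ) (hσ1 : σ ≤ 1) (hR : 1 ≤ R) (hε : 0 < ε)
    (hK0 : 0 ≤ K) (hK : ∫ x in closedBall 0 (3 * R), speed U x ^ 3 ≤ K * R) :
    σ * |∑ i, pairing (σ ^ 2) (pd i P) (fun y => y i * ρ y) (divCut U ψ)| ≤
      9 * B * (ε * ((K + unitVol) * (6 * (C ^ 2 * ((1 + 27 * unitVol) * cubicMean U R) +
        C * localEnergy U ψ))) + ε⁻¹ * (unitVol * cubicMean U R)) := by
  have hR0 : 0 < R := by linarith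
  have hC := h.const_nonneg
  have hB := hm.nonneg
  have hv := unitVol_nonneg
  have hca := speed_continuous fun i => (hNS.contDiff i).continuous
  have hf := divCut_contDiff hNS.contDiff h.contDiff
  rw [sum_pairing_radial_eq_right hNS.contDiff hNS.momentum hNS.div_eq_zero (σ ^ 2)
    hm.contDiff_potential hf
    hm.vanishOut_potential.hasCompactSupport (divCut_vanishOut h.vanishOut).hasCompactSupport
    hm.pd_potential, abs_neg]
  have h4 := setIntegral_speed_cube_div_le U hR0.le
  have hs1 : σ ^ 2 ≤ 1 := pow_le_one₀ hσ.le hσ1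
  set M := ∫ x in closedBall 0 (3 * R), speed U x ^ 3 with hM
  set T := 6 * (C ^ 2 * ((1 + 27 * unitVol) * cubicMean U R) + C * localEnergy U ψ) with hT
  have key : ∀ i j, |pairing (σ ^ 2) (fun y => U j y * U i y) (pd i Θ) (pd j (divCut U ψ))| ≤
      σ⁻¹ * (B * (ε * ((K + unitVol) * T) + ε⁻¹ * (unitVol * cubicMean U R))) := by
    intro i j
    have h1 := abs_pairing_le_weighted (a := speed U) (A := fun y => U j y * U i y)
      (b := pd i Θ) (c := pd j (divCut U ψ)) (R := R) (s := σ ^ 2) (K := K) (B := B)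
      (τ := ε * R * σ) hca (speed_nonneg U) (abs_mul_le_speed_sq U i j)
      (pd_contDiff hf j).continuous (hm.abs_pd_potential_le i) (hm.vanishOut_potential.pd i)
      ((divCut_vanishOut h.vanishOut).pd j) (by positivity) hs1 hR (by positivity) hK
    have h2 := h.setIntegral_sq_pd_divCut_le hNS hR j
    rw [← hT] at h2
    rw [← hM] at h1
    set Q := ∫ x in closedBall 0 (2 * R), pd j (divCut U ψ) x ^ 2
    refine h1.trans ?_
    calc _ = σ⁻¹ * (B * (ε * ((K + unitVol) * (R ^ 2 * Q)) + ε⁻¹ * (unitVol * (M / R)))) := by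
          unfold unitVol
          field_simp
      _ ≤ _ := by gcongr
  calc _ ≤ σ * (9 * (σ⁻¹ * (B * (ε * ((K + unitVol) * T) +
        ε⁻¹ * (unitVol * cubicMean U R))))) := by
        gcongr
        exact abs_sum_sum_le key
    _ = _ := by field_simp

end Scale

/-! ### The local energy estimate -/

section Energy

variable {U : Fin 3 → E3 → ℝ} {P ψ Θ ρ : E3 → ℝ} {B C R : ℝ}

theorem pairing_zero (a b c : E3 → ℝ) :
    pairing 0 a b c = (∫ y, b y) * ∫ x, a x * c x := by
  unfold pairing
  simp_rw [zero_smul, add_zero]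
  rw [mul_comm, Measure.volume_eq_prod, ← integral_prod_mul]
  congr 1
  ext w
  ring

theorem ScaledCutoff.localEnergy_le (h : ScaledCutoff C R ψ) (hNS : SmoothNS U P) (hR : 1 ≤ R) :
    localEnergy U ψ ≤ 2 * |∫ x, P x * divCut U ψ x| +
      3 * C * (2 + 27 * unitVol) * cubicMean U R := by
  have hR0 : 0 < R := by linarith
  have hC := h.const_nonneg
  have hv := unitVol_nonneg
  have hcU := fun i => (hNS.contDiff i).continuous
  have hcU' := fun i j => (pd_contDiff (hNS.contDiff i) j).continuous
  have hcψ := h.contDiff.continuous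
  have hcψ' := fun i => (pd_contDiff h.contDiff i).continuous
  have hcP := hNS.contDiff_pressure.continuous
  have hca := speed_continuous hcU
  have hcf := (divCut_contDiff hNS.contDiff h.contDiff).continuous
  have hf := divCut_eq hNS h.contDiff
  have hi : ∀ {f : E3 → ℝ}, Continuous f → IntegrableOn f (closedBall (0 : E3) (3 * R)) :=
    fun hf => hf.continuousOn.integrableOn_compact (isCompact_closedBall _ _)
  set Q : E3 → ℝ := fun x => 1 / 2 * (∑ i, U i x ^ 2) * ∑ j, pd j ψ x * U j x -
    ∑ i, ∑ j, pd j (U i) x * pd j ψ x * U i x with hQ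
  have hQc : Continuous Q := by fun_prop
  have hQv : VanishOut (2 * R) Q := fun x hx => by
    simp [hQ, (h.vanishOut.pd _) x hx]
  have hPv : VanishOut (2 * R) fun x => P x * divCut U ψ x := fun x hx => by
    simp [divCut_vanishOut h.vanishOut x hx]
  have e : localEnergy U ψ = (∫ x, P x * divCut U ψ x) + ∫ x, Q x := by
    have hPi : Integrable fun x => P x * divCut U ψ x :=
      (hcP.mul hcf).integrable_of_hasCompactSupport hPv.hasCompactSupport
    rw [← integral_add hPi (hQc.integrable_of_hasCompactSupport hQv.hasCompactSupport), hf]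
    exact local_energy hNS.contDiff_pressure hNS.contDiff hNS.momentum hNS.div_eq_zero
      h.contDiff h.vanishOut.hasCompactSupport
  have hQle : ∀ x, Q x ≤ 3 * C / 2 * (speed U x ^ 3 / R) +
      1 / 2 * (ψ x * ∑ i, ∑ j, pd j (U i) x ^ 2) + 3 * C / 2 * (speed U x ^ 2 / R ^ 2) := by
    intro x
    have hψ0 := h.nonneg x
    have hs := speed_nonneg U x
    have h1 : 1 / 2 * (∑ i, U i x ^ 2) * ∑ j, pd j ψ x * U j x ≤
        3 * C / 2 * (speed U x ^ 3 / R) := by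
      have h2 := (le_abs_self _).trans (h.abs_divCut_le hNS hR0 x)
      rw [hf] at h2
      rw [← speed_sq]
      calc _ ≤ 1 / 2 * speed U x ^ 2 * (3 * C / R * speed U x) := by gcongr
        _ = _ := by ring
    have h3 : ∀ i j, -(pd j (U i) x * pd j ψ x * U i x) ≤
        1 / 2 * (ψ x * pd j (U i) x ^ 2) + C / 2 * (U i x ^ 2 / R ^ 2) := by
      intro i j
      refine (neg_le_abs _).trans (abs_le_of_sq_le_sq ?_ (by positivity))
      have h4 : pd j ψ x ^ 2 ≤ C * ψ x / R ^ 2 := by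
        rw [le_div_iff₀ (by positivity), mul_comm, ← mul_pow]
        exact h.sq_pd_le j x
      calc (pd j (U i) x * pd j ψ x * U i x) ^ 2
          = pd j (U i) x ^ 2 * U i x ^ 2 * pd j ψ x ^ 2 := by ring
        _ ≤ pd j (U i) x ^ 2 * U i x ^ 2 * (C * ψ x / R ^ 2) := by gcongr
        _ = 4 * (1 / 2 * (ψ x * pd j (U i) x ^ 2)) * (C / 2 * (U i x ^ 2 / R ^ 2)) := by ring
        _ ≤ _ := by
          nlinarith [sq_nonneg (1 / 2 * (ψ x * pd j (U i) x ^ 2) - C / 2 * (U i x ^ 2 / R ^ 2))]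
    have h5 : -∑ i, ∑ j, pd j (U i) x * pd j ψ x * U i x ≤
        1 / 2 * (ψ x * ∑ i, ∑ j, pd j (U i) x ^ 2) + 3 * C / 2 * (speed U x ^ 2 / R ^ 2) := by
      simp_rw [← Finset.sum_neg_distrib]
      refine (Finset.sum_le_sum fun i _ => Finset.sum_le_sum fun j _ => h3 i j).trans_eq ?_
      rw [speed_sq]
      simp only [Fin.sum_univ_three]
      ring
    simp only [hQ]
    linarith
  have hQint : ∫ x, Q x ≤ 3 * C / 2 * ((∫ x in closedBall 0 (3 * R), speed U x ^ 3) / R) +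
      1 / 2 * localEnergy U ψ +
      3 * C / 2 * ((∫ x in closedBall 0 (3 * R), speed U x ^ 2) / R ^ 2) := by
    have h1 : ∫ x in closedBall 0 (3 * R), Q x = ∫ x, Q x :=
      setIntegral_eq_integral_of_forall_compl_eq_zero fun x hx => by
        rw [mem_closedBall_zero_iff, not_le] at hx
        exact hQv x (by linarith)
    have h2 : ∫ x in closedBall 0 (3 * R), ψ x * ∑ i, ∑ j, pd j (U i) x ^ 2 =
        localEnergy U ψ :=
      setIntegral_eq_integral_of_forall_compl_eq_zero fun x hx => by
        rw [mem_closedBall_zero_iff, not_le] at hx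
        rw [h.vanishOut x (by linarith), zero_mul]
    rw [← h1, ← h2]
    refine (setIntegral_mono (hi hQc) (hi ?_) hQle).trans_eq ?_
    · fun_prop
    · rw [integral_add (hi (by fun_prop)) (hi (by fun_prop)),
        integral_add (hi (by fun_prop)) (hi (by fun_prop)), integral_const_mul,
        integral_const_mul, integral_const_mul, integral_div, integral_div]
  have h6 := setIntegral_speed_sq_div_le hcU hR
  have h7 := setIntegral_speed_cube_div_le U hR0.le
  have h8 := le_abs_self (∫ x, P x * divCut U ψ x)
  have h9 := mul_le_mul_of_nonneg_left h6 (by positivity : 0 ≤ 3 * C / 2)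
  have h10 := mul_le_mul_of_nonneg_left h7 (by positivity : 0 ≤ 3 * C / 2)
  linarith

theorem abs_pairing_sub_le_log (hNS : SmoothNS U P) (h : ScaledCutoff C R ψ)
    (hm : RadialMollifier Θ ρ B) (hR : 1 ≤ R) :
    |pairing R P ρ (divCut U ψ) - pairing 1 P ρ (divCut U ψ)| ≤
      54 * unitVol * (C * B) * cubicMean U R * Real.log R := by
  have hR0 : 0 < R := by linarith
  have hd : ∀ τ : ℝ, HasDerivAt (fun τ => pairing (Real.exp τ) P ρ (divCut U ψ))
      (Real.exp τ * ∑ i, pairing (Real.exp τ) (pd i P) (fun y => y i * ρ y) (divCut U ψ)) τ := by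
    intro τ
    have h1 := pairing_hasDerivAt (Real.exp τ) hNS.contDiff_pressure hm.contDiff
      (divCut_contDiff hNS.contDiff h.contDiff) hm.vanishOut.hasCompactSupport
      (divCut_vanishOut h.vanishOut).hasCompactSupport
    have h2 := h1.comp τ (Real.hasDerivAt_exp τ)
    rw [mul_comm]
    exact h2
  have h1 := norm_image_sub_le_of_norm_deriv_le_segment' (a := 0) (b := Real.log R)
    (C := 54 * unitVol * (C * B) * cubicMean U R) (fun τ _ => (hd τ).hasDerivWithinAt)
    (fun τ hτ => mul_abs_sum_pairing_radial_le hNS h hm (Real.exp_pos τ).le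
      ((Real.le_log_iff_exp_le hR0).1 hτ.2.le) hR) _ (Set.right_mem_Icc.2 (Real.log_nonneg hR))
  simpa [Real.exp_log hR0] using h1

theorem abs_pairing_one_sub_zero_le (hNS : SmoothNS U P) (h : ScaledCutoff C R ψ)
    (hm : RadialMollifier Θ ρ B) {ε K : ℝ} (hR : 1 ≤ R) (hε : 0 < ε)
    (hK0 : 0 ≤ K) (hK : ∫ x in closedBall 0 (3 * R), speed U x ^ 3 ≤ K * R) :
    |pairing 1 P ρ (divCut U ψ) - pairing 0 P ρ (divCut U ψ)| ≤
      18 * B * (ε * ((K + unitVol) * (6 * (C ^ 2 * ((1 + 27 * unitVol) * cubicMean U R) +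
        C * localEnergy U ψ))) + ε⁻¹ * (unitVol * cubicMean U R)) := by
  have hR0 : 0 < R := by linarith
  have hC := h.const_nonneg
  have hB := hm.nonneg
  have hv := unitVol_nonneg
  have hX := cubicMean_nonneg U hR0.le
  have hE := h.localEnergy_nonneg (U := U)
  have hd : ∀ σ : ℝ, HasDerivAt (fun σ : ℝ => pairing (σ ^ 2) P ρ (divCut U ψ))
      (2 * (σ * ∑ i, pairing (σ ^ 2) (pd i P) (fun y => y i * ρ y) (divCut U ψ))) σ := by
    intro σ
    have h1 := pairing_hasDerivAt (σ ^ 2) hNS.contDiff_pressure hm.contDiff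
      (divCut_contDiff hNS.contDiff h.contDiff) hm.vanishOut.hasCompactSupport
      (divCut_vanishOut h.vanishOut).hasCompactSupport
    have h2 := HasDerivAt.comp (h := fun σ : ℝ => σ ^ 2) σ h1 (hasDerivAt_pow 2 σ)
    refine h2.congr_deriv ?_
    push_cast
    ring
  have h1 := norm_image_sub_le_of_norm_deriv_le_segment_01' (fun σ _ => (hd σ).hasDerivWithinAt)
    (C := 18 * B * (ε * ((K + unitVol) * (6 * (C ^ 2 * ((1 + 27 * unitVol) * cubicMean U R) +
        C * localEnergy U ψ))) + ε⁻¹ * (unitVol * cubicMean U R))) fun σ hσ => ?_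
  · simpa using h1
  · rcases hσ.1.eq_or_lt with h0 | h0
    · rw [← h0]
      simp only [zero_mul, mul_zero, norm_zero]
      positivity
    · have h2 := abs_sum_pairing_radial_le hNS h hm h0 hσ.2.le hR hε hK0 hK
      rw [Real.norm_eq_abs, abs_mul, abs_mul, abs_of_pos h0, abs_two]
      linarith

theorem localEnergy_le_log (hNS : SmoothNS U P) (hm : RadialMollifier Θ ρ B) (hC : 0 ≤ C) {K : ℝ}
    (hK0 : 0 ≤ K) : ∃ D, ∀ R ψ, 1 ≤ R → ScaledCutoff C R ψ →
      ∫ x in closedBall 0 (3 * R), speed U x ^ 3 ≤ K * R →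
      localEnergy U ψ ≤ D * (1 + Real.log R) * cubicMean U R := by
  have hB := hm.nonneg
  have hv := unitVol_nonneg
  have hmpos := hm.integral_pos
  set m := ∫ y, ρ y
  set S := 216 * B * (K + unitVol) * C with hS
  have hS0 : 0 ≤ S := by positivity
  set ε := m / (2 * (S + 1)) with hε
  have hε0 : 0 < ε := by positivity
  have hεS : ε * S ≤ m / 2 := by
    rw [hε, div_mul_eq_mul_div, div_le_div_iff₀ (by positivity) two_pos]
    nlinarith
  set A1 := 18 * unitVol * (C * B) * (2 + 27 * unitVol) with hA1
  set A2 := 54 * unitVol * (C * B) with hA2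
  set A3 := 18 * B * (ε * ((K + unitVol) * (6 * (C ^ 2 * (1 + 27 * unitVol)))) +
    ε⁻¹ * unitVol) with hA3
  set A4 := 3 * C * (2 + 27 * unitVol) with hA4
  have hA1' : 0 ≤ A1 := by positivity
  have hA2' : 0 ≤ A2 := by positivity
  have hA3' : 0 ≤ A3 := by positivity
  have hA4' : 0 ≤ A4 := by positivity
  refine ⟨2 / m * (2 * A1 + 2 * A2 + 2 * A3 + m * A4), fun R ψ hR h hK => ?_⟩
  have hX := cubicMean_nonneg U (by linarith : 0 ≤ R)
  have hL := Real.log_nonneg hR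
  have h1 := abs_pairing_pressure_le hNS h hm hR
  have h2 := abs_pairing_sub_le_log hNS h hm hR
  have h3 := abs_pairing_one_sub_zero_le hNS h hm hR hε0 hK0 hK
  have h4 := h.localEnergy_le hNS hR
  have h5 : m * |∫ x, P x * divCut U ψ x| = |pairing 0 P ρ (divCut U ψ)| := by
    rw [pairing_zero, abs_mul, abs_of_pos hmpos]
  set X := cubicMean U R
  set L := Real.log R
  set E := localEnergy U ψ
  set J0 := pairing 0 P ρ (divCut U ψ)
  set J1 := pairing 1 P ρ (divCut U ψ)
  set JR := pairing R P ρ (divCut U ψ)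
  have h6 : |J0| ≤ A1 * X + A2 * X * L + (A3 * X + ε * S / 2 * E) := by
    have h7 : |J0| ≤ |JR| + |JR - J1| + |J1 - J0| := by
      rw [abs_sub_comm JR J1, abs_sub_comm J1 J0]
      calc |J0| = |JR + (J1 - JR) + (J0 - J1)| := by ring_nf
        _ ≤ _ := abs_add_three _ _ _
    have h8 : 18 * B * (ε * ((K + unitVol) * (6 * (C ^ 2 * ((1 + 27 * unitVol) * X) +
        C * E))) + ε⁻¹ * (unitVol * X)) = A3 * X + ε * S / 2 * E := by
      rw [hA3, hS]
      ring
    linarith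
  have hE := h.localEnergy_nonneg (U := U)
  have h9 : m * E ≤ 2 * |J0| + m * (A4 * X) := by
    rw [← h5]
    calc m * E ≤ m * (2 * |∫ x, P x * divCut U ψ x| + A4 * X) := by gcongr
      _ = _ := by ring
  have h10 : ε * S * E ≤ m / 2 * E := by gcongr
  have h11 : m / 2 * E ≤ (2 * A1 + 2 * A2 + 2 * A3 + m * A4) * (1 + L) * X := by
    have h12 : 0 ≤ (2 * A1 + 2 * A3 + m * A4) * L * X := by positivity
    have h13 : 0 ≤ A2 * X := by positivity
    nlinarith
  calc E = 2 / m * (m / 2 * E) := by field_simp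
    _ ≤ 2 / m * ((2 * A1 + 2 * A2 + 2 * A3 + m * A4) * (1 + L) * X) := by gcongr
    _ = _ := by ring

end Energy

/-! ### Consequences of the Morrey condition -/

section Morrey

variable {U : Fin 3 → E3 → ℝ} {P : E3 → ℝ}

theorem eq_const_of_pd_eq_zero {f : E3 → ℝ} (hf : Differentiable ℝ f) (h : ∀ i x, pd i f x = 0)
    (x y : E3) : f x = f y := by
  refine is_const_of_fderiv_eq_zero hf (fun z => ?_) x y
  have : (fderiv ℝ f z : E3 →ₗ[ℝ] ℝ) = 0 := by
    refine (EuclideanSpace.basisFun (Fin 3) ℝ).toBasis.ext fun i => ?_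
    simpa [pd] using h i z
  ext v
  exact LinearMap.congr_fun this v

theorem cube_le_rpow_add {t k p : ℝ} (ht : 0 ≤ t) (hk : 0 < k) (hp : 3 ≤ p) :
    t ^ 3 ≤ k ^ (3 - p) * t ^ p + k ^ 3 := by
  rcases le_total t k with h | h
  · have h1 : t ^ 3 ≤ k ^ 3 := by gcongr
    have h2 : 0 ≤ k ^ (3 - p) * t ^ p := by positivity
    linarith
  · have ht0 : 0 < t := hk.trans_le h
    have h1 : t ^ (3 - p) ≤ k ^ (3 - p) := Real.rpow_le_rpow_of_nonpos hk h (by linarith)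
    have h2 : t ^ 3 = t ^ (3 - p) * t ^ p := by
      rw [← Real.rpow_add ht0, sub_add_cancel]
      norm_cast
    rw [h2]
    have h3 : t ^ (3 - p) * t ^ p ≤ k ^ (3 - p) * t ^ p := by gcongr
    have h4 : 0 ≤ k ^ 3 := by positivity
    linarith

theorem MemMorrey.setIntegral_cube_le {a : E3 → ℝ} {p γ : ℝ} (ha : Continuous a)
    (ha0 : ∀ x, 0 ≤ a x) (hp : 3 ≤ p) (h : MemMorrey p γ a) :
    ∃ D, 0 ≤ D ∧ ∀ R : ℝ, 1 ≤ R →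
      ∫ x in closedBall 0 R, a x ^ 3 ≤ D * R ^ (3 + 3 * ((γ - 3) / p)) := by
  obtain ⟨-, C, hC⟩ := h
  have hp0 : 0 < p := by linarith
  have hv := unitVol_nonneg
  have hcp : Continuous fun x => a x ^ p := ha.rpow_const fun x => Or.inr hp0.le
  have hball : ∀ R : ℝ, 1 ≤ R → ∫ x in closedBall 0 R, a x ^ p ≤ C * (2 * R) ^ γ := by
    intro R hR
    have h1 := hC (2 * R) (by linarith)
    simp_rw [abs_of_nonneg (ha0 _)] at h1
    have hpos : 0 < (2 * R) ^ γ := by positivity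
    rw [Real.rpow_neg (by positivity), inv_mul_le_iff₀ hpos, mul_comm ((2 * R) ^ γ) C] at h1
    refine le_trans (setIntegral_mono_set ?_ (Eventually.of_forall fun x => ?_) ?_) h1
    · exact (hcp.continuousOn.integrableOn_compact (isCompact_closedBall 0 (2 * R))).mono_set
        ball_subset_closedBall
    · exact Real.rpow_nonneg (ha0 x) p
    · exact (closedBall_subset_ball (by linarith)).eventuallyLE
  have hC0 : 0 ≤ C := by
    have h1 : 0 ≤ ∫ x in closedBall 0 1, a x ^ p :=
      integral_nonneg fun x => Real.rpow_nonneg (ha0 x) p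
    have h2 := h1.trans (hball 1 le_rfl)
    exact nonneg_of_mul_nonneg_left h2 (by positivity)
  refine ⟨C * 2 ^ γ + unitVol, by positivity, fun R hR => ?_⟩
  have hR0 : 0 < R := by linarith
  have hi : ∀ {f : E3 → ℝ}, Continuous f → IntegrableOn f (closedBall (0 : E3) R) :=
    fun hf => hf.continuousOn.integrableOn_compact (isCompact_closedBall _ _)
  set k := R ^ ((γ - 3) / p) with hk
  have hk0 : 0 < k := by positivity
  have e1 : k ^ 3 * R ^ 3 = R ^ (3 + 3 * ((γ - 3) / p)) := by
    rw [hk, ← Real.rpow_natCast, ← Real.rpow_natCast, ← Real.rpow_mul hR0.le, ← Real.rpow_add hR0]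
    congr 1
    push_cast
    ring
  have e2 : k ^ (3 - p) * R ^ γ = R ^ (3 + 3 * ((γ - 3) / p)) := by
    rw [hk, ← Real.rpow_mul hR0.le, ← Real.rpow_add hR0]
    congr 1
    field_simp
    ring
  calc ∫ x in closedBall 0 R, a x ^ 3
      ≤ ∫ x in closedBall 0 R, (k ^ (3 - p) * a x ^ p + k ^ 3) :=
        setIntegral_mono (hi (by fun_prop)) (hi (by fun_prop)) fun x =>
          cube_le_rpow_add (ha0 x) hk0 hp
    _ = k ^ (3 - p) * (∫ x in closedBall 0 R, a x ^ p) + unitVol * (k ^ 3 * R ^ 3) := by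
        rw [integral_add (hi (by fun_prop)) (hi (by fun_prop)), integral_const_mul,
          setIntegral_const, smul_eq_mul, Measure.addHaar_real_closedBall' _ _ hR0.le,
          finrank_euclideanSpace_fin, unitVol]
        ring
    _ ≤ k ^ (3 - p) * (C * (2 * R) ^ γ) + unitVol * (k ^ 3 * R ^ 3) := by
        gcongr
        exact hball R hR
    _ = C * 2 ^ γ * (k ^ (3 - p) * R ^ γ) + unitVol * (k ^ 3 * R ^ 3) := by
        rw [Real.mul_rpow two_pos.le hR0.le]
        ring
    _ = _ := by
        rw [e1, e2]
        ring

theorem tendsto_log_mul_rpow_neg {b : ℝ} (hb : 0 < b) :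
    Tendsto (fun R : ℝ => (1 + Real.log R) * R ^ (-b)) atTop (nhds 0) := by
  have h1 := (isLittleO_log_rpow_atTop hb).tendsto_div_nhds_zero
  have h2 := (tendsto_rpow_neg_atTop hb).add h1
  rw [add_zero] at h2
  refine h2.congr' ?_
  filter_upwards [eventually_gt_atTop 0] with R hR
  rw [Real.rpow_neg hR.le]
  ring

/-- Subcritical growth of the cubic integral forces the velocity to be constant. -/
theorem SmoothNS.pd_eq_zero (hNS : SmoothNS U P) {D α : ℝ} (hD : 0 ≤ D) (hα : α < 1)
    (h : ∀ R : ℝ, 1 ≤ R → ∫ x in closedBall 0 R, speed U x ^ 3 ≤ D * R ^ α) (i j : Fin 3)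
    (x : E3) : pd j (U i) x = 0 := by
  obtain ⟨C, hC, hψ⟩ := exists_scaledCutoff
  obtain ⟨Θ, ρ, B, hm⟩ := exists_radialMollifier
  set K := D * 3 ^ α with hKdef
  have hK0 : 0 ≤ K := by positivity
  have hM : ∀ R : ℝ, 1 ≤ R → ∫ x in closedBall 0 (3 * R), speed U x ^ 3 ≤ K * R ^ α := by
    intro R hR
    refine (h (3 * R) (by linarith)).trans_eq ?_
    rw [Real.mul_rpow (by norm_num) (by linarith), hKdef]
    ring
  obtain ⟨A, hA⟩ := localEnergy_le_log hNS hm hC hK0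
  set q : E3 → ℝ := fun x => ∑ i, ∑ j, pd j (U i) x ^ 2 with hq
  have hcU' := fun i j => (pd_contDiff (hNS.contDiff i) j).continuous
  have hqc : Continuous q := by fun_prop
  have hq0 : ∀ x, 0 ≤ q x := fun x =>
    Finset.sum_nonneg fun _ _ => Finset.sum_nonneg fun _ _ => sq_nonneg _
  have hbound : ∀ R : ℝ, 1 ≤ R → ∫ x in closedBall 0 R, q x ≤
      |A| * (K * ((1 + Real.log R) * R ^ (-(1 - α))) + (1 + Real.log R) * R ^ (-1 : ℝ)) := by
    intro R hR
    have hR0 : 0 < R := by linarith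
    have hL := Real.log_nonneg hR
    obtain ⟨ψ, hψR⟩ := hψ R hR
    have h1 : ∫ x in closedBall 0 R, q x ≤ localEnergy U ψ := by
      have h2 : ∫ x in closedBall 0 R, q x = ∫ x in closedBall 0 R, ψ x * q x :=
        setIntegral_congr_fun isClosed_closedBall.measurableSet fun x hx => by
          rw [hψR.eq_one x (by simpa using hx), one_mul]
      rw [h2]
      refine setIntegral_le_integral ?_ (Eventually.of_forall fun x =>
        mul_nonneg (hψR.nonneg x) (hq0 x))
      exact (hψR.contDiff.continuous.mul hqc).integrable_of_hasCompactSupport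
        (hψR.vanishOut.mul_right q).hasCompactSupport
    have hRα : R ^ α ≤ R := by
      conv_rhs => rw [← Real.rpow_one R]
      exact Real.rpow_le_rpow_of_exponent_le hR hα.le
    have h3 := hA R ψ hR hψR ((hM R hR).trans (by gcongr))
    have h4 : cubicMean U R ≤ K * R ^ (-(1 - α)) + R ^ (-1 : ℝ) := by
      have e1 : R ^ (-(1 - α)) = R ^ α / R := by
        rw [neg_sub, Real.rpow_sub_one hR0.ne']
      rw [e1, Real.rpow_neg_one, cubicMean, add_div, ← one_div, mul_div_assoc']
      gcongr
      exact hM R hR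
    have h5 := cubicMean_nonneg U hR0.le
    calc ∫ x in closedBall 0 R, q x ≤ A * (1 + Real.log R) * cubicMean U R := h1.trans h3
      _ ≤ |A| * (1 + Real.log R) * (K * R ^ (-(1 - α)) + R ^ (-1 : ℝ)) := by
          gcongr
          exact le_abs_self A
      _ = _ := by ring
  have hlim : Tendsto (fun R : ℝ => |A| * (K * ((1 + Real.log R) * R ^ (-(1 - α))) +
      (1 + Real.log R) * R ^ (-1 : ℝ))) atTop (nhds 0) := by
    have h1 := ((((tendsto_log_mul_rpow_neg (sub_pos.2 hα)).const_mul K).add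
      (tendsto_log_mul_rpow_neg one_pos)).const_mul |A|)
    simpa using h1
  have hi : ∀ r, IntegrableOn q (closedBall (0 : E3) r) :=
    fun r => hqc.continuousOn.integrableOn_compact (isCompact_closedBall _ _)
  set r := ‖x‖ + 1
  have hzero : ∫ x in ball 0 r, q x ≤ 0 := by
    refine ge_of_tendsto hlim ?_
    filter_upwards [eventually_ge_atTop 1, eventually_ge_atTop r] with R hR hRr
    refine le_trans (setIntegral_mono_set (hi R) (Eventually.of_forall hq0) ?_) (hbound R hR)
    exact (ball_subset_closedBall.trans (closedBall_subset_closedBall hRr)).eventuallyLE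
  have hae := (setIntegral_eq_zero_iff_of_nonneg_ae (Eventually.of_forall hq0)
    ((hi r).mono_set ball_subset_closedBall)).1 (le_antisymm hzero (integral_nonneg hq0))
  have hqx : q x = 0 := Measure.eqOn_open_of_ae_eq hae isOpen_ball hqc.continuousOn
    continuousOn_const (by simp [r])
  have h1 := (Finset.sum_eq_zero_iff_of_nonneg fun _ _ =>
    Finset.sum_nonneg fun _ _ => sq_nonneg _).1 hqx i (Finset.mem_univ i)
  have h2 := (Finset.sum_eq_zero_iff_of_nonneg fun _ _ => sq_nonneg _).1 h1 j (Finset.mem_univ j)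
  exact pow_eq_zero_iff two_ne_zero |>.1 h2

theorem SmoothNS.eq_zero (hNS : SmoothNS U P) {D α : ℝ} (hD : 0 ≤ D) (hα : α < 1)
    (h : ∀ R : ℝ, 1 ≤ R → ∫ x in closedBall 0 R, speed U x ^ 3 ≤ D * R ^ α) (i : Fin 3) (x : E3) :
    U i x = 0 := by
  have hconst : ∀ i x, U i x = U i 0 := fun i x =>
    eq_const_of_pd_eq_zero (hNS.contDiff i).diff_top (fun j => hNS.pd_eq_zero hD hα h i j) x 0
  have hs : ∀ x, speed U x = speed U 0 := fun x => by
    unfold speed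
    simp_rw [hconst _ x]
  have hβ : 0 < unitVol :=
    ENNReal.toReal_pos (measure_closedBall_pos volume 0 one_pos).ne' measure_closedBall_lt_top.ne
  have hR : ∀ R : ℝ, 1 ≤ R → speed U 0 ^ 3 * unitVol * R ≤ D := by
    intro R hR
    have hR0 : 0 < R := by linarith
    have h1 := h R hR
    have hc := speed_nonneg U 0
    simp_rw [hs] at h1
    rw [setIntegral_const, smul_eq_mul, Measure.addHaar_real_closedBall' _ _ hR0.le,
      finrank_euclideanSpace_fin] at h1
    change R ^ 3 * unitVol * _ ≤ _ at h1
    have hRα : R ^ α ≤ R := by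
      conv_rhs => rw [← Real.rpow_one R]
      exact Real.rpow_le_rpow_of_exponent_le hR hα.le
    have h2 : speed U 0 ^ 3 * unitVol * R ^ 2 * R ≤ D * R := by
      calc _ = R ^ 3 * unitVol * speed U 0 ^ 3 := by ring
        _ ≤ D * R ^ α := h1
        _ ≤ D * R := by gcongr
    refine le_trans ?_ (le_of_mul_le_mul_right h2 hR0)
    have : R ≤ R ^ 2 := by nlinarith
    gcongr
  have hs0 : speed U 0 = 0 := by
    by_contra hne
    have hc : 0 < speed U 0 := lt_of_le_of_ne (speed_nonneg U 0) (Ne.symm hne)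
    have hq : 0 < speed U 0 ^ 3 * unitVol := by positivity
    have h1 := hR (D / (speed U 0 ^ 3 * unitVol) + 1) (by linarith [div_nonneg hD hq.le])
    rw [mul_add, mul_div_cancel₀ _ hq.ne'] at h1
    linarith
  have h1 := abs_le_speed U i x
  rw [hs, hs0] at h1
  exact abs_nonpos_iff.1 h1

end Morrey

theorem StatNS.smoothNS {u : E3 → Fin 3 → ℝ} {P : E3 → ℝ} (hu : ContDiff ℝ (⊤ : ℕ∞) u)
    (hP : ContDiff ℝ (⊤ : ℕ∞) P) (h : StatNS u P) : SmoothNS (fun i y => u y i) P where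
  contDiff := contDiff_pi.1 hu
  contDiff_pressure := hP
  momentum i x := by
    have := h.1 x i
    unfold lap at this
    linarith
  div_eq_zero := h.2

theorem liouville_stationary_NS_eta_neg
    (u : E3 → Fin 3 → ℝ) (P : E3 → ℝ) (γ p : ℝ)
    (hu : ContDiff ℝ (⊤ : ℕ∞) u) (hP : ContDiff ℝ (⊤ : ℕ∞) P)
    (hsol : StatNS u P)
    (hγ0 : 0 < γ) (hγ3 : γ < 3) (hp3 : 3 ≤ p)
    (hη : γ / p - 3 / p + 2 / 3 < 0)
    (hum : MemMorrey p γ (vecNorm u)) :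
    (∀ x : E3, ∀ i : Fin 3, u x i = 0) ∧ (∃ c : ℝ, ∀ x : E3, P x = c) := by
  have hNS := hsol.smoothNS hu hP
  obtain ⟨D, hD, h⟩ := MemMorrey.setIntegral_cube_le (a := speed fun i y => u y i)
    (speed_continuous fun i => (hNS.contDiff i).continuous) (speed_nonneg _) hp3 hum
  have hα : 3 + 3 * ((γ - 3) / p) < 1 := by
    rw [sub_div]
    linarith
  have hu0 : ∀ i x, u x i = 0 := hNS.eq_zero hD hα h
  refine ⟨fun x i => hu0 i x, P 0, fun x => eq_const_of_pd_eq_zero hP.diff_top (fun i x => ?_) x 0⟩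
  rw [hNS.momentum]
  have hz : (fun y => u y i) = fun _ => 0 := funext (hu0 i)
  have hpd : ∀ j, pd j (fun _ : E3 => (0 : ℝ)) = fun _ => 0 := fun j => by
    funext y
    simp [pd]
  simp [hz, hpd]
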